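/- arXiv:1912.05739 — 3 statements merged into one kernel-verified Lean document; each statement's English description precedes it below -/
import Mathlib

section
/- A zero-mean nonsingular Gaussian sequence [x_k], k ∈ [0,N], is CM_L if and only if it obeys a CM_L model: there exist d×d matrices G_{k,k−1}, G_{k,N} for k ∈ [1,N−1], a matrix G_{0,N}, and zero-mean jointly Gaussian, mutually uncorrelated random vectors e_k, k ∈ [0,N], with positive definite covariances G_k = Cov(e_k), such that x_k = G_{k,k−1} x_{k−1} + G_{k,N} x_N + e_k for all k ∈ [1,N−1], with boundary condition x_N = e_N and x_0 = G_{0,N} x_N + e_0. -/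
open MeasureTheory ProbabilityTheory Matrix
open scoped NNReal

namespace CMSeqPaper

variable {Ω : Type*} [MeasurableSpace Ω]

/-- Square `d × d` real matrices. -/
abbrev Mat (d : ℕ) := Matrix (Fin d) (Fin d) ℝ

/-- `X` is a zero-mean jointly Gaussian random vector with covariance matrix `C`
(Cramér–Wold characterization: every linear functional of `X` is a centered real
Gaussian with the induced variance). -/
def IsZeroMeanGaussian {ι : Type*} [Fintype ι] (μ : Measure Ω)
    (X : Ω → ι → ℝ) (C : Matrix ι ι ℝ) : Prop :=
  ∀ l : ι → ℝ,
    μ.map (fun ω => ∑ i, l i * X ω i) = gaussianReal 0 (l ⬝ᵥ C.mulVec l).toNNReal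

/-- The stacked vector over times `0, …, N` of a `d`-dimensional sequence. -/
def stack (N d : ℕ) (x : ℕ → Ω → Fin d → ℝ) : Ω → Fin (N + 1) × Fin d → ℝ :=
  fun ω p => x (p.1 : ℕ) ω p.2

/-- `[x_k]`, `k ∈ [0,N]`, is a zero-mean nonsingular Gaussian sequence whose stacked
vector has (positive definite) covariance matrix `C`. -/
def ZMNG (N d : ℕ) (μ : Measure Ω) (x : ℕ → Ω → Fin d → ℝ)
    (C : Matrix (Fin (N + 1) × Fin d) (Fin (N + 1) × Fin d) ℝ) : Prop :=
  (∀ k, k ≤ N → Measurable (x k)) ∧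
    IsZeroMeanGaussian μ (stack N d x) C ∧ C.PosDef

/-- The σ-algebra generated by the states at the times in `S`. -/
def sigmaOf {d : ℕ} (x : ℕ → Ω → Fin d → ℝ) (S : Set ℕ) : MeasurableSpace Ω :=
  ⨆ i ∈ S, MeasurableSpace.comap (x i) inferInstance

/-- The conditional distribution of `x k` given the states at the times in `S`
coincides (a.e.) with the conditional distribution of `x k` given the states at the
times in `T`. -/
def CondEq {d : ℕ} (μ : Measure Ω) (x : ℕ → Ω → Fin d → ℝ) (k : ℕ)
    (S T : Set ℕ) : Prop :=
  ∀ A : Set (Fin d → ℝ), MeasurableSet A →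
    μ[A.indicator (fun _ => (1 : ℝ)) ∘ x k | sigmaOf x S]
      =ᵐ[μ] μ[A.indicator (fun _ => (1 : ℝ)) ∘ x k | sigmaOf x T]

/-- `[x_k]` is `[k₁,k₂]`-CM_c: for all `k₁ ≤ j < k ≤ k₂`, the conditional
distribution of `x k` given `(x_{k₁}, …, x_j, x_c)` equals the one given `(x_j, x_c)`. -/
def IsCM {d : ℕ} (μ : Measure Ω) (x : ℕ → Ω → Fin d → ℝ) (k₁ k₂ c : ℕ) : Prop :=
  ∀ j k, k₁ ≤ j → j < k → k ≤ k₂ →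
    CondEq μ x k (Set.Icc k₁ j ∪ {c}) ({j} ∪ {c})

/-- `[x_k]` is Markov on the index interval `[a,b]`. -/
def IsMarkovOn {d : ℕ} (μ : Measure Ω) (x : ℕ → Ω → Fin d → ℝ) (a b : ℕ) : Prop :=
  ∀ j k, a ≤ j → j < k → k ≤ b → CondEq μ x k (Set.Icc a j) {j}

/-- `[x_k]` is reciprocal on `[0,N]`. -/
def IsReciprocal {d : ℕ} (μ : Measure Ω) (x : ℕ → Ω → Fin d → ℝ) (N : ℕ) : Prop :=
  ∀ j k l, j < k → k < l → l ≤ N →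
    CondEq μ x k (Set.Icc 0 j ∪ Set.Icc l N) ({j} ∪ {l})

/-- Block `(i,j)` of the block matrix `A` is zero. -/
def BlockZero {n d : ℕ} (A : Matrix (Fin n × Fin d) (Fin n × Fin d) ℝ)
    (i j : Fin n) : Prop :=
  ∀ a b, A (i, a) (j, b) = 0

/-- `|i - j| ≥ 2` for block indices. -/
def Far {n : ℕ} (i j : Fin n) : Prop :=
  (i : ℕ) + 2 ≤ (j : ℕ) ∨ (j : ℕ) + 2 ≤ (i : ℕ)

/-- Block tri-diagonal: every block `(i,j)` with `|i-j| ≥ 2` is zero. -/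
def BlockTriDiag {n d : ℕ} (A : Matrix (Fin n × Fin d) (Fin n × Fin d) ℝ) : Prop :=
  ∀ i j, Far i j → BlockZero A i j

/-- The CM_L form: every block `(i,j)` with `|i-j| ≥ 2` is zero except possibly
blocks in the last block row and last block column. -/
def HasCMLForm {n d : ℕ} (A : Matrix (Fin n × Fin d) (Fin n × Fin d) ℝ) : Prop :=
  ∀ i j, Far i j → (i : ℕ) ≠ n - 1 → (j : ℕ) ≠ n - 1 → BlockZero A i j

/-- The CM_F form: every block `(i,j)` with `|i-j| ≥ 2` is zero except possibly
blocks in the first block row and first block column. -/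
def HasCMFForm {n d : ℕ} (A : Matrix (Fin n × Fin d) (Fin n × Fin d) ℝ) : Prop :=
  ∀ i j, Far i j → (i : ℕ) ≠ 0 → (j : ℕ) ≠ 0 → BlockZero A i j

/-- Cyclic block tri-diagonal: every block `(i,j)` with `|i-j| ≥ 2` is zero except
possibly the corner blocks `(0, n-1)` and `(n-1, 0)`. -/
def CyclicBlockTriDiag {n d : ℕ} (A : Matrix (Fin n × Fin d) (Fin n × Fin d) ℝ) : Prop :=
  ∀ i j, Far i j → ¬((i : ℕ) = 0 ∧ (j : ℕ) = n - 1) →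
    ¬((i : ℕ) = n - 1 ∧ (j : ℕ) = 0) → BlockZero A i j

/-- The stacked block-diagonal matrix with diagonal blocks `G 0, …, G N`. -/
def blockDiag (N d : ℕ) (G : ℕ → Mat d) :
    Matrix (Fin (N + 1) × Fin d) (Fin (N + 1) × Fin d) ℝ :=
  fun p q => if (p.1 : ℕ) = (q.1 : ℕ) then G (p.1 : ℕ) p.2 q.2 else 0

/-- `[x_k]` obeys the CM_L model with parameters `Gm k = G_{k,k-1}` and
`GN k = G_{k,N}` for `k ∈ [1,N-1]`, boundary parameter `GN 0 = G_{0,N}`, and noise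
covariances `Gcov k = G_k = Cov(e_k)`: the `e_k` are zero-mean jointly Gaussian,
mutually uncorrelated, with positive definite covariances, with
`x_k = G_{k,k-1} x_{k-1} + G_{k,N} x_N + e_k` for `k ∈ [1,N-1]`, and boundary
condition `x_N = e_N`, `x_0 = G_{0,N} x_N + e_0`. -/
def CMLModel (N d : ℕ) (μ : Measure Ω) (x : ℕ → Ω → Fin d → ℝ)
    (Gm GN Gcov : ℕ → Mat d) : Prop :=
  ∃ e : ℕ → Ω → Fin d → ℝ,
    ZMNG N d μ e (blockDiag N d Gcov) ∧
    (∀ k, k ≤ N → (Gcov k).PosDef) ∧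
    (∀ᵐ ω ∂μ,
      (∀ k, 1 ≤ k → k ≤ N - 1 →
        x k ω = (Gm k).mulVec (x (k - 1) ω) + (GN k).mulVec (x N ω) + e k ω) ∧
      x N ω = e N ω ∧ x 0 ω = (GN 0).mulVec (x N ω) + e 0 ω)

/-- `[y_k]` obeys the Markov model with parameters `Mm k = M_{k,k-1}` for
`k ∈ [1,N]` and noise covariances `Mcov k = M_k = Cov(e_k)`: the `e_k` are
zero-mean jointly Gaussian, mutually uncorrelated, with positive definite
covariances, `y_0 = e_0` and `y_k = M_{k,k-1} y_{k-1} + e_k` for `k ∈ [1,N]`. -/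
def MarkovModel (N d : ℕ) (μ : Measure Ω) (y : ℕ → Ω → Fin d → ℝ)
    (Mm Mcov : ℕ → Mat d) : Prop :=
  ∃ e : ℕ → Ω → Fin d → ℝ,
    ZMNG N d μ e (blockDiag N d Mcov) ∧
    (∀ k, k ≤ N → (Mcov k).PosDef) ∧
    (∀ᵐ ω ∂μ, y 0 ω = e 0 ω ∧
      ∀ k, 1 ≤ k → k ≤ N → y k ω = (Mm k).mulVec (y (k - 1) ω) + e k ω)

/-- Representation of `[x_k]` as a zero-mean nonsingular Gaussian Markov sequence
plus `Γ_k x_c`, where `c ∈ {0,N}`: `y` (which coincides with `x` at time `c`) is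
jointly zero-mean nonsingular Gaussian, the states of `y` at times `≠ c` are
uncorrelated with `y c = x c`, `y` is Markov on `[0,N] \ {c}`, and
`x_k = y_k + Γ_k x_c` for `k ∈ [0,N] \ {c}`. -/
def MarkovPlusVector (N d c : ℕ) (μ : Measure Ω) (x y : ℕ → Ω → Fin d → ℝ)
    (Γ : ℕ → Mat d) : Prop :=
  ∃ C' : Matrix (Fin (N + 1) × Fin d) (Fin (N + 1) × Fin d) ℝ,
    (∀ᵐ ω ∂μ, y c ω = x c ω) ∧
    ZMNG N d μ y C' ∧
    (∀ i j : Fin (N + 1),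
      (((i : ℕ) = c ∧ (j : ℕ) ≠ c) ∨ ((i : ℕ) ≠ c ∧ (j : ℕ) = c)) →
      ∀ a b, C' (i, a) (j, b) = 0) ∧
    IsMarkovOn μ y (if c = 0 then 1 else 0) (if c = 0 then N else N - 1) ∧
    (∀ᵐ ω ∂μ, ∀ k, k ≤ N → k ≠ c → x k ω = y k ω + (Γ k).mulVec (x c ω))

/-- `M_{N|k} = M_{N,N-1} ⋯ M_{k+1,k}` (with `M_{N|N} = I`), where `Mm k = M_{k,k-1}`. -/
def MNk (d : ℕ) (Mm : ℕ → Mat d) (N k : ℕ) : Mat d :=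
  (List.range (N - k)).foldl (fun A i => A * Mm (N - i)) 1

/-- `C_{N|k} = ∑_{n=k}^{N-1} M_{N|n+1} M_{n+1} M_{N|n+1}'`. -/
def CNk (d : ℕ) (Mm Mcov : ℕ → Mat d) (N k : ℕ) : Mat d :=
  ∑ n ∈ Finset.Icc k (N - 1), MNk d Mm N (n + 1) * Mcov (n + 1) * (MNk d Mm N (n + 1))ᵀ

/-- The `(N+1)d × (N+1)d` matrix `[[B₁, 0], [0, 0]]` (`B₁` occupies the first `N`
block rows and columns). -/
def embedL (N d : ℕ) (B₁ : Matrix (Fin N × Fin d) (Fin N × Fin d) ℝ) :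
    Matrix (Fin (N + 1) × Fin d) (Fin (N + 1) × Fin d) ℝ :=
  fun p q =>
    if h : (p.1 : ℕ) < N ∧ (q.1 : ℕ) < N then
      B₁ (⟨(p.1 : ℕ), h.1⟩, p.2) (⟨(q.1 : ℕ), h.2⟩, q.2)
    else 0

/-- The `(N+1)d × d` matrix `Γ = [S; I]`. -/
def gammaL (N d : ℕ) (S : Matrix (Fin N × Fin d) (Fin d) ℝ) :
    Matrix (Fin (N + 1) × Fin d) (Fin d) ℝ :=
  fun p a =>
    if h : (p.1 : ℕ) < N then S (⟨(p.1 : ℕ), h⟩, p.2) a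
    else (1 : Mat d) p.2 a

/-- The `(N+1)d × (N+1)d` matrix `[[0, 0], [0, B₂]]` (`B₂` occupies the last `N`
block rows and columns). -/
def embedF (N d : ℕ) (B₂ : Matrix (Fin N × Fin d) (Fin N × Fin d) ℝ) :
    Matrix (Fin (N + 1) × Fin d) (Fin (N + 1) × Fin d) ℝ :=
  fun p q =>
    if h : 0 < (p.1 : ℕ) ∧ 0 < (q.1 : ℕ) then
      B₂ (⟨(p.1 : ℕ) - 1, by have := p.1.isLt; omega⟩, p.2)
        (⟨(q.1 : ℕ) - 1, by have := q.1.isLt; omega⟩, q.2)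
    else 0

/-- The `(N+1)d × d` matrix `Γ = [I; S]`. -/
def gammaF (N d : ℕ) (S : Matrix (Fin N × Fin d) (Fin d) ℝ) :
    Matrix (Fin (N + 1) × Fin d) (Fin d) ℝ :=
  fun p a =>
    if h : 0 < (p.1 : ℕ) then
      S (⟨(p.1 : ℕ) - 1, by have := p.1.isLt; omega⟩, p.2) a
    else (1 : Mat d) p.2 a

section Helpers

variable {ι κ : Type*} [Fintype ι] [Fintype κ]

lemma gauss_of_zm {μ : Measure Ω} {Z : Ω → ι → ℝ} {C : Matrix ι ι ℝ}
    (hZ : Measurable Z) (h : IsZeroMeanGaussian μ Z C) : HasGaussianLaw Z μ := by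
  classical
  constructor
  refine isGaussian_of_map_eq_gaussianReal fun L => ?_
  refine ⟨0, ((fun i => L (Pi.single i 1)) ⬝ᵥ C.mulVec (fun i => L (Pi.single i 1))).toNNReal, ?_⟩
  · rw [Measure.map_map (by fun_prop) hZ, ← h (fun i => L (Pi.single i 1))]
    congr 1
    ext ω
    have := L.toLinearMap.pi_apply_eq_sum_univ (Z ω)
    simp only [ContinuousLinearMap.coe_coe] at this
    simp only [Function.comp, this, smul_eq_mul]
    refine Finset.sum_congr rfl fun i _ => ?_
    rw [mul_comm]
    congr 2
    ext j
    simp [Pi.single_apply, eq_comm]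

lemma memLp_eval {μ : Measure Ω} {Z : Ω → ι → ℝ} (h : HasGaussianLaw Z μ) (i : ι) :
    MemLp (fun ω => Z ω i) 2 μ :=
  (h.map_fun (ContinuousLinearMap.proj (R := ℝ) (φ := fun _ : ι => ℝ) i)).memLp_two

lemma mean_lin {μ : Measure Ω} [IsProbabilityMeasure μ] {Z : Ω → ι → ℝ} {C : Matrix ι ι ℝ}
    (hZ : Measurable Z) (h : IsZeroMeanGaussian μ Z C) (i : ι) :
    ∫ ω, Z ω i ∂μ = 0 := by
  classical
  have h1 := h (Pi.single i 1)
  have h2 : (fun ω => ∑ j, (Pi.single i 1 : ι → ℝ) j * Z ω j) = fun ω => Z ω i := by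
    ext ω; simp [Pi.single_apply]
  rw [h2] at h1
  have h3 : ∫ ω, Z ω i ∂μ = ∫ y, y ∂(μ.map (fun ω => Z ω i)) := by
    rw [integral_map (by fun_prop) (by fun_prop)]
  rw [h3, h1]
  simp

lemma var_lin {μ : Measure Ω} [IsProbabilityMeasure μ] {Z : Ω → ι → ℝ} {C : Matrix ι ι ℝ}
    (hZ : Measurable Z) (hC : C.PosDef) (h : IsZeroMeanGaussian μ Z C) (l : ι → ℝ) :
    Var[fun ω => ∑ i, l i * Z ω i; μ] = l ⬝ᵥ C.mulVec l := by
  have h1 := h l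
  have h3 : Var[fun ω => ∑ i, l i * Z ω i; μ]
      = Var[id; μ.map (fun ω => ∑ i, l i * Z ω i)] := by
    rw [variance_map (by fun_prop) (by fun_prop)]
    rfl
  rw [h3, h1, variance_id_gaussianReal]
  have := hC.posSemidef.dotProduct_mulVec_nonneg l
  simpa using this

lemma cov_eval {μ : Measure Ω} [IsProbabilityMeasure μ] {Z : Ω → ι → ℝ} {C : Matrix ι ι ℝ}
    (hZ : Measurable Z) (hC : C.PosDef) (h : IsZeroMeanGaussian μ Z C) (i j : ι) :
    cov[fun ω => Z ω i, fun ω => Z ω j; μ] = C i j := by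
  classical
  have hg := gauss_of_zm hZ h
  have hi := memLp_eval hg i
  have hj := memLp_eval hg j
  have hv : ∀ k, Var[fun ω => Z ω k; μ] = C k k := by
    intro k
    have := var_lin hZ hC h (Pi.single k 1)
    simpa [Pi.single_apply] using this
  have h1 := var_lin hZ hC h (Pi.single i 1 + Pi.single j 1)
  have h2 : (fun ω => ∑ k, (Pi.single i 1 + Pi.single j 1 : ι → ℝ) k * Z ω k)
      = fun ω => Z ω i + Z ω j := by
    ext ω; simp [Pi.single_apply, add_mul, Finset.sum_add_distrib]
  rw [h2, variance_fun_add hi hj, hv, hv] at h1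
  have hs : C j i = C i j := by simpa using hC.1.apply i j
  simp [Matrix.mulVec_add, add_dotProduct] at h1
  linarith

lemma zm_of_gauss {μ : Measure Ω} [IsProbabilityMeasure μ] {Z : Ω → ι → ℝ} {C : Matrix ι ι ℝ}
    (h : HasGaussianLaw Z μ) (hm : ∀ i, ∫ ω, Z ω i ∂μ = 0)
    (hc : ∀ i j, cov[fun ω => Z ω i, fun ω => Z ω j; μ] = C i j) :
    IsZeroMeanGaussian μ Z C := by
  intro l
  have hL : HasGaussianLaw (fun ω => ∑ i, l i * Z ω i) μ := by
    have := h.map_fun (∑ i, l i • ContinuousLinearMap.proj (R := ℝ) (φ := fun _ : ι => ℝ) i)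
    simpa using this
  have hme := memLp_eval h
  rw [hL.map_eq_gaussianReal]
  congr 1
  · rw [integral_finsetSum _ (fun i _ => ((hme i).integrable (by norm_num)).const_mul _)]
    simp [integral_const_mul, hm]
  · congr 1
    rw [← covariance_self hL.aemeasurable,
      covariance_fun_sum_fun_sum (fun i => (hme i).const_mul _) (fun i => (hme i).const_mul _)]
    simp only [covariance_const_mul_left, covariance_const_mul_right, hc]
    simp only [dotProduct, mulVec, Finset.mul_sum]
    refine Finset.sum_congr rfl fun i _ => Finset.sum_congr rfl fun j _ => by ring

lemma exists_solve {C : Matrix ι ι ℝ} (hC : C.PosDef) (f : κ → ι) (hf : Function.Injective f)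
    (b : κ → ℝ) : ∃ c : κ → ℝ, ∀ q, ∑ p, c p * C (f p) (f q) = b q := by
  classical
  have hp : (C.submatrix f f).PosDef := hC.submatrix hf
  refine ⟨b ᵥ* (C.submatrix f f)⁻¹, fun q => ?_⟩
  have : (b ᵥ* (C.submatrix f f)⁻¹) ᵥ* (C.submatrix f f) = b := by
    rw [vecMul_vecMul, Matrix.nonsing_inv_mul _ ((Matrix.isUnit_iff_isUnit_det _).1 hp.isUnit)]
    simp
  have := congrFun this q
  simpa [vecMul, dotProduct] using this

end Helpers

section Cond

lemma freeze {Ω' α E : Type*} {F : MeasurableSpace Ω'} [mΩ : MeasurableSpace Ω'] [MeasurableSpace α] [MeasurableSpace E]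
    {μ : Measure Ω'} [IsProbabilityMeasure μ] (hF : F ≤ mΩ)
    {Y : Ω' → α} {w : Ω' → E} (hY : Measurable[F] Y) (hw : Measurable w)
    (hind : Indep (MeasurableSpace.comap w inferInstance) F μ)
    {A : Set (α × E)} (hA : MeasurableSet A) :
    μ[fun ω => A.indicator (fun _ => (1 : ℝ)) (Y ω, w ω) | F]
      =ᵐ[μ] fun ω => (μ.map w).real (Prod.mk (Y ω) ⁻¹' A) := by
  have hY' : Measurable Y := hY.mono hF le_rfl
  have : IsProbabilityMeasure (μ.map w) := Measure.isProbabilityMeasure_map hw.aemeasurable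
  have hΦ : Measurable fun y : α => (μ.map w).real (Prod.mk y ⁻¹' A) :=
    (measurable_measure_prodMk_left hA).ennreal_toReal
  have hΦY : Measurable[F] fun ω => (μ.map w).real (Prod.mk (Y ω) ⁻¹' A) := hΦ.comp hY
  have hΦi : Integrable (fun ω => (μ.map w).real (Prod.mk (Y ω) ⁻¹' A)) μ := by
    refine Integrable.of_bound (C := 1) (hΦ.comp hY').aestronglyMeasurable ?_
    refine Filter.Eventually.of_forall fun ω => ?_
    rw [Real.norm_of_nonneg measureReal_nonneg]
    exact measureReal_le_one
  have hm : Measurable fun ω => A.indicator (fun _ => (1 : ℝ)) (Y ω, w ω) :=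
    (measurable_const.indicator hA).comp (hY'.prodMk hw)
  have hi : Integrable (fun ω => A.indicator (fun _ => (1 : ℝ)) (Y ω, w ω)) μ := by
    refine Integrable.of_bound (C := 1) hm.aestronglyMeasurable ?_
    refine Filter.Eventually.of_forall fun ω => ?_
    by_cases h : (Y ω, w ω) ∈ A <;> simp [h]
  symm
  refine ae_eq_condExp_of_forall_setIntegral_eq hF hi (fun s _ _ => hΦi.integrableOn) ?_
    hΦY.stronglyMeasurable.aestronglyMeasurable
  intro B hB _
  have hprod : ((μ.restrict B).map Y).prod (μ.map w)
      = (μ.restrict B).map (fun ω => (Y ω, w ω)) := by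
    refine Measure.prod_eq fun s t hs ht => ?_
    rw [Measure.map_apply (hY'.prodMk hw) (hs.prod ht), Measure.map_apply hY' hs,
      Measure.map_apply hw ht, Measure.restrict_apply (hY' hs),
      Measure.restrict_apply ((hY'.prodMk hw) (hs.prod ht))]
    have h1 := (Indep_iff _ _ μ).1 hind (w ⁻¹' t) (Y ⁻¹' s ∩ B) ⟨t, ht, rfl⟩
      (MeasurableSet.inter (hY hs) hB)
    rw [mul_comm, ← h1]
    congr 1
    ext ω
    simp only [Set.mem_inter_iff, Set.mem_preimage, Set.mem_prod]
    tauto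
  have e1 : ∫ ω in B, A.indicator (fun _ => (1 : ℝ)) (Y ω, w ω) ∂μ
      = ((μ.restrict B).map (fun ω => (Y ω, w ω))).real A := by
    rw [← integral_map (φ := fun ω => (Y ω, w ω)) (f := A.indicator (fun _ => (1 : ℝ)))
      (hY'.prodMk hw).aemeasurable (measurable_const.indicator hA).aestronglyMeasurable,
      integral_indicator_const _ hA]
    simp
  have e2 : ∫ ω in B, (μ.map w).real (Prod.mk (Y ω) ⁻¹' A) ∂μ
      = ∫ y, (μ.map w).real (Prod.mk y ⁻¹' A) ∂((μ.restrict B).map Y) := by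
    rw [integral_map hY'.aemeasurable hΦ.aestronglyMeasurable]
  rw [e1, e2, ← hprod, measureReal_def, Measure.prod_apply hA]
  simp only [measureReal_def]
  rw [integral_toReal (measurable_measure_prodMk_left hA).aemeasurable
    (Filter.Eventually.of_forall fun y => measure_lt_top _ _)]

lemma condExp_ext {Ω' E : Type*} {F G : MeasurableSpace Ω'} [mΩ : MeasurableSpace Ω'] [MeasurableSpace E] {μ : Measure Ω'} [IsProbabilityMeasure μ]
    {X : Ω' → E} (hX : Measurable X)
    (h : ∀ A : Set E, MeasurableSet A →
      μ[A.indicator (fun _ => (1 : ℝ)) ∘ X | F] =ᵐ[μ] μ[A.indicator (fun _ => (1 : ℝ)) ∘ X | G])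
    {f : E → ℝ} (hf : Measurable f) (hfi : Integrable (f ∘ X) μ) :
    μ[f ∘ X | F] =ᵐ[μ] μ[f ∘ X | G] := by
  have hsi : ∀ g : SimpleFunc E ℝ, Integrable (g ∘ X) μ := by
    intro g
    obtain ⟨c, hc⟩ := g.exists_forall_norm_le
    exact Integrable.of_bound (C := c) (g.measurable.comp hX).aestronglyMeasurable
      (Filter.Eventually.of_forall fun ω => hc _)
  have hs : ∀ g : SimpleFunc E ℝ, μ[g ∘ X | F] =ᵐ[μ] μ[g ∘ X | G] := by
    intro g
    induction g using SimpleFunc.induction with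
    | @const c s hs =>
      have : (SimpleFunc.piecewise s hs (SimpleFunc.const _ c) (SimpleFunc.const _ 0)) ∘ X
          = c • (s.indicator (fun _ => (1 : ℝ)) ∘ X) := by
        ext ω
        by_cases hω : X ω ∈ s <;> simp [hω]
      rw [this]
      refine (condExp_smul c _ F).trans (Filter.EventuallyEq.trans ?_ (condExp_smul c _ G).symm)
      filter_upwards [h s hs] with ω hω
      simp [hω]
    | @add f g _ hf hg =>
      have : (f + g : SimpleFunc E ℝ) ∘ X = f ∘ X + g ∘ X := rfl
      rw [this]
      refine (condExp_add (hsi f) (hsi g) F).trans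
        (Filter.EventuallyEq.trans ?_ (condExp_add (hsi f) (hsi g) G).symm)
      exact hf.add hg
  have hfm : MemLp f 1 (μ.map X) := by
    rw [memLp_map_measure_iff hf.aestronglyMeasurable hX.aemeasurable]
    exact memLp_one_iff_integrable.2 hfi
  have hz : eLpNorm (μ[f ∘ X | F] - μ[f ∘ X | G]) 1 μ = 0 := by
    refine le_antisymm (le_of_forall_pos_le_add fun ε hε => ?_) bot_le
    obtain ⟨g, hg, -⟩ := hfm.exists_simpleFunc_eLpNorm_sub_lt (by simp)
      (ε := ε / 2) (by simpa using hε.ne')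
    have hg' : eLpNorm (f ∘ X - g ∘ X) 1 μ < ε / 2 := by
      rw [eLpNorm_map_measure (hf.sub g.measurable).aestronglyMeasurable hX.aemeasurable] at hg
      exact hg
    have key : ∀ m : MeasurableSpace Ω',
        eLpNorm (μ[f ∘ X | m] - μ[g ∘ X | m]) 1 μ ≤ ε / 2 := by
      intro m
      rw [← eLpNorm_congr_ae (condExp_sub hfi (hsi g) m)]
      exact (eLpNorm_condExp_le_eLpNorm _ le_rfl).trans hg'.le
    have hsplit : μ[f ∘ X | F] - μ[f ∘ X | G] =ᵐ[μ]
        (μ[f ∘ X | F] - μ[g ∘ X | F]) - (μ[f ∘ X | G] - μ[g ∘ X | G]) := by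
      filter_upwards [hs g] with ω hω
      simp [hω]
    rw [eLpNorm_congr_ae hsplit, zero_add]
    refine (eLpNorm_sub_le (integrable_condExp.sub integrable_condExp).aestronglyMeasurable
      (integrable_condExp.sub integrable_condExp).aestronglyMeasurable le_rfl).trans ?_
    calc _ ≤ ε / 2 + ε / 2 := add_le_add (key F) (key G)
      _ = ε := ENNReal.add_halves ε
  rw [eLpNorm_eq_zero_iff (integrable_condExp.sub integrable_condExp).aestronglyMeasurable
    (by simp)] at hz
  filter_upwards [hz] with ω hω
  simpa [sub_eq_zero] using hω

end Cond

section Seq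

/-- Projection of a stacked vector on its `k`-th block. -/
def pj (N d k : ℕ) : (Fin (N + 1) × Fin d → ℝ) →ₗ[ℝ] (Fin d → ℝ) :=
  LinearMap.funLeft ℝ ℝ (fun a => (Fin.ofNat (N + 1) k, a))

/-- The linear map `z ↦ z_k - A z_j - B z_N`. -/
noncomputable def Res (N d k j : ℕ) (A B : Mat d) :
    (Fin (N + 1) × Fin d → ℝ) →ₗ[ℝ] (Fin d → ℝ) :=
  pj N d k - A.mulVecLin ∘ₗ pj N d j - B.mulVecLin ∘ₗ pj N d N

/-- The vector of covariances of the components of `x k` with `u`. -/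
noncomputable def rv {d : ℕ} (μ : Measure Ω) (x : ℕ → Ω → Fin d → ℝ) (k : ℕ) (u : Ω → ℝ) :
    Fin d → ℝ :=
  fun a => cov[fun ω => x k ω a, u; μ]

variable {N d : ℕ} {μ : Measure Ω} {x : ℕ → Ω → Fin d → ℝ}
  {C : Matrix (Fin (N + 1) × Fin d) (Fin (N + 1) × Fin d) ℝ}

lemma pj_stack {k : ℕ} (hk : k ≤ N) (ω : Ω) : pj N d k (stack N d x ω) = x k ω := by
  ext a
  simp [pj, stack, LinearMap.funLeft, Nat.mod_eq_of_lt (Nat.lt_succ_of_le hk)]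

lemma res_stack {k j : ℕ} (hk : k ≤ N) (hj : j ≤ N) (A B : Mat d) (ω : Ω) :
    Res N d k j A B (stack N d x ω) = x k ω - A *ᵥ x j ω - B *ᵥ x N ω := by
  simp [Res, pj_stack hk, pj_stack hj, pj_stack le_rfl]

lemma meas_stack (hm : ∀ k, k ≤ N → Measurable (x k)) : Measurable (stack N d x) := by
  refine measurable_pi_lambda _ fun p => ?_
  exact (measurable_pi_apply p.2).comp (hm p.1 (Nat.le_of_lt_succ p.1.2))

lemma ZMNG.gauss (hx : ZMNG N d μ x C) : HasGaussianLaw (stack N d x) μ :=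
  gauss_of_zm (meas_stack hx.1) hx.2.1

lemma ZMNG.memLp (hx : ZMNG N d μ x C) {k : ℕ} (hk : k ≤ N) (a : Fin d) :
    MemLp (fun ω => x k ω a) 2 μ :=
  memLp_eval hx.gauss (⟨k, Nat.lt_succ_of_le hk⟩, a)

lemma ZMNG.mean [IsProbabilityMeasure μ] (hx : ZMNG N d μ x C) {k : ℕ} (hk : k ≤ N) (a : Fin d) :
    ∫ ω, x k ω a ∂μ = 0 :=
  mean_lin (meas_stack hx.1) hx.2.1 (⟨k, Nat.lt_succ_of_le hk⟩, a)

lemma ZMNG.cov [IsProbabilityMeasure μ] (hx : ZMNG N d μ x C) {k j : ℕ} (hk : k ≤ N) (hj : j ≤ N)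
    (a b : Fin d) :
    cov[fun ω => x k ω a, fun ω => x j ω b; μ]
      = C (⟨k, Nat.lt_succ_of_le hk⟩, a) (⟨j, Nat.lt_succ_of_le hj⟩, b) :=
  cov_eval (meas_stack hx.1) hx.2.2 hx.2.1 (⟨k, Nat.lt_succ_of_le hk⟩, a)
    (⟨j, Nat.lt_succ_of_le hj⟩, b)

lemma memLp_mulVec {y : Ω → Fin d → ℝ} (hy : ∀ a, MemLp (fun ω => y ω a) 2 μ) (A : Mat d)
    (a : Fin d) : MemLp (fun ω => (A *ᵥ y ω) a) 2 μ := by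
  simp only [mulVec, dotProduct]
  exact memLp_finsetSum _ fun b _ => (hy b).const_mul _

lemma cov_mulVec [IsProbabilityMeasure μ] {y : Ω → Fin d → ℝ}
    (hy : ∀ a, MemLp (fun ω => y ω a) 2 μ) (A : Mat d)
    (a : Fin d) {u : Ω → ℝ} (hu : MemLp u 2 μ) :
    cov[fun ω => (A *ᵥ y ω) a, u; μ] = (A *ᵥ fun b => cov[fun ω => y ω b, u; μ]) a := by
  simp only [mulVec, dotProduct]
  rw [covariance_fun_sum_left (fun b => (hy b).const_mul _) hu]
  simp only [covariance_const_mul_left]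

lemma cov_congr_left {f g u : Ω → ℝ} (h : f =ᵐ[μ] g) : cov[f, u; μ] = cov[g, u; μ] := by
  have h2 : μ[f] = μ[g] := integral_congr_ae h
  unfold covariance
  rw [h2]
  refine integral_congr_ae ?_
  filter_upwards [h] with ω hω
  rw [hω]

lemma memLp_res (hx : ZMNG N d μ x C) {k j : ℕ} (hk : k ≤ N) (hj : j ≤ N) (A B : Mat d)
    (a : Fin d) : MemLp (fun ω => Res N d k j A B (stack N d x ω) a) 2 μ := by
  simp only [res_stack hk hj, Pi.sub_apply]
  exact ((hx.memLp hk a).sub (memLp_mulVec (hx.memLp hj) A a)).sub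
    (memLp_mulVec (hx.memLp le_rfl) B a)

lemma cov_res [IsProbabilityMeasure μ] (hx : ZMNG N d μ x C) {k j : ℕ} (hk : k ≤ N) (hj : j ≤ N)
    (A B : Mat d) (a : Fin d) {u : Ω → ℝ} (hu : MemLp u 2 μ) :
    cov[fun ω => Res N d k j A B (stack N d x ω) a, u; μ]
      = (rv μ x k u - A *ᵥ rv μ x j u - B *ᵥ rv μ x N u) a := by
  simp only [res_stack hk hj, Pi.sub_apply]
  rw [covariance_fun_sub_left (X := fun ω => x k ω a - (A *ᵥ x j ω) a) ((hx.memLp hk a).sub (memLp_mulVec (hx.memLp hj) A a))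
    (memLp_mulVec (hx.memLp le_rfl) B a) hu,
    covariance_fun_sub_left (hx.memLp hk a) (memLp_mulVec (hx.memLp hj) A a) hu,
    cov_mulVec (hx.memLp hj) A a hu, cov_mulVec (hx.memLp le_rfl) B a hu]
  rfl

lemma sigma_le (hm : ∀ k, k ≤ N → Measurable (x k)) {S : Set ℕ} (hS : ∀ i ∈ S, i ≤ N) :
    sigmaOf x S ≤ ‹MeasurableSpace Ω› :=
  iSup₂_le fun i hi => (hm i (hS i hi)).comap_le

lemma meas_sigma {S : Set ℕ} {i : ℕ} (hi : i ∈ S) : Measurable[sigmaOf x S] (x i) := by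
  rw [measurable_iff_comap_le]
  exact le_iSup₂ (f := fun i (_ : i ∈ S) => MeasurableSpace.comap (x i) inferInstance) i hi

lemma indep_res (hx : ZMNG N d μ x C) {S : Set ℕ} (hS : ∀ i ∈ S, i ≤ N)
    (L : (Fin (N + 1) × Fin d → ℝ) →ₗ[ℝ] (Fin d → ℝ))
    (h : ∀ i ∈ S, ∀ a b,
      cov[fun ω => L (stack N d x ω) a, fun ω => x i ω b; μ] = 0) :
    Indep (MeasurableSpace.comap (fun ω => L (stack N d x ω)) inferInstance)
      (sigmaOf x S) μ := by
  classical
  let κ := {p : Fin (N + 1) × Fin d // (p.1 : ℕ) ∈ S}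
  let R : (Fin (N + 1) × Fin d → ℝ) →ₗ[ℝ] (κ → ℝ) := LinearMap.funLeft ℝ ℝ Subtype.val
  have hg : HasGaussianLaw
      (fun ω ↦ (fun a ↦ L (stack N d x ω) a, fun p ↦ R (stack N d x ω) p)) μ :=
    hx.gauss.map_fun (LinearMap.toContinuousLinearMap (L.prod R))
  have hi := hg.indepFun_of_covariance_eval (X := fun a ω => L (stack N d x ω) a)
    (Y := fun p ω => R (stack N d x ω) p) (fun a p => h p.1.1 p.2 a p.1.2)
  have hi' := (IndepFun_iff_Indep _ _ _).1 hi
  refine indep_of_indep_of_le_right hi' ?_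
  refine iSup₂_le fun i hiS => ?_
  have hiN := Nat.lt_succ_of_le (hS i hiS)
  rw [← measurable_iff_comap_le]
  have : x i = (fun z : κ → ℝ => fun a : Fin d => z ⟨(⟨i, hiN⟩, a), hiS⟩) ∘
      (fun ω p => R (stack N d x ω) p) := by
    ext ω a
    rfl
  rw [this]
  exact Measurable.comp (by fun_prop) (comap_measurable _)

/-- Sufficient linear criterion for the equality of conditional distributions. -/
lemma condEq_of_cov [IsProbabilityMeasure μ] (hx : ZMNG N d μ x C) {j k : ℕ} (hk : k ≤ N)
    (hj : j ≤ N) {A B : Mat d} {S T : Set ℕ} (hS : ∀ i ∈ S, i ≤ N)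
    (hTS : T ⊆ S) (hjT : j ∈ T) (hNT : N ∈ T)
    (h : ∀ i ∈ S, ∀ b, rv μ x k (fun ω => x i ω b)
      = A *ᵥ rv μ x j (fun ω => x i ω b) + B *ᵥ rv μ x N (fun ω => x i ω b)) :
    CondEq μ x k S T := by
  intro D hD
  have hm := hx.1
  set w : Ω → Fin d → ℝ := fun ω => Res N d k j A B (stack N d x ω) with hw
  have hwm : Measurable w :=
    (LinearMap.continuous_of_finiteDimensional _).measurable.comp (meas_stack hm)
  have hind : Indep (MeasurableSpace.comap w inferInstance) (sigmaOf x S) μ := by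
    refine indep_res hx hS _ fun i hi a b => ?_
    rw [cov_res hx hk hj A B a (hx.memLp (hS i hi) b), h i hi b]
    simp
  have hST : sigmaOf x T ≤ sigmaOf x S :=
    iSup₂_le fun i hi => (measurable_iff_comap_le.1 (meas_sigma (hTS hi)))
  have hind' := indep_of_indep_of_le_right hind hST
  let g : ((Fin d → ℝ) × (Fin d → ℝ)) × (Fin d → ℝ) → (Fin d → ℝ) :=
    fun q => A *ᵥ q.1.1 + B *ᵥ q.1.2 + q.2
  have hgm : Measurable g := by
    refine Continuous.measurable ?_
    have h1 : Continuous fun v : Fin d → ℝ => A *ᵥ v := A.mulVecLin.continuous_of_finiteDimensional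
    have h2 : Continuous fun v : Fin d → ℝ => B *ᵥ v := B.mulVecLin.continuous_of_finiteDimensional
    exact ((h1.comp (continuous_fst.comp continuous_fst)).add
      (h2.comp (continuous_snd.comp continuous_fst))).add continuous_snd
  have heq : D.indicator (fun _ => (1 : ℝ)) ∘ x k =
      fun ω => (g ⁻¹' D).indicator (fun _ => (1 : ℝ)) ((x j ω, x N ω), w ω) := by
    ext ω
    have : g ((x j ω, x N ω), w ω) = x k ω := by
      simp only [g, hw, res_stack hk hj]
      abel
    have h2 : ((x j ω, x N ω), w ω) ∈ g ⁻¹' D ↔ x k ω ∈ D := by rw [Set.mem_preimage, this]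
    by_cases h1 : x k ω ∈ D
    · rw [Function.comp, Set.indicator_of_mem h1, Set.indicator_of_mem (h2.2 h1)]
    · rw [Function.comp, Set.indicator_of_notMem h1,
        Set.indicator_of_notMem (fun h3 => h1 (h2.1 h3))]
  rw [heq]
  have hYT : Measurable[sigmaOf x T] fun ω => (x j ω, x N ω) :=
    (meas_sigma hjT).prodMk (meas_sigma hNT)
  have hTN : ∀ i ∈ T, i ≤ N := fun i hi => hS i (hTS hi)
  exact (freeze (sigma_le hm hS) (hYT.mono hST le_rfl) hwm hind (hgm hD)).trans
    (freeze (sigma_le hm hTN) hYT hwm hind' (hgm hD)).symm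

end Seq

section Main

variable {N d : ℕ} {μ : Measure Ω} {x : ℕ → Ω → Fin d → ℝ}
  {C : Matrix (Fin (N + 1) × Fin d) (Fin (N + 1) × Fin d) ℝ}

lemma exists_pred [IsProbabilityMeasure μ] (hx : ZMNG N d μ x C) {k j : ℕ} (hk : k ≤ N)
    (hj : j < N) : ∃ A B : Mat d, ∀ i, i = j ∨ i = N → ∀ b,
      rv μ x k (fun ω => x i ω b)
        = A *ᵥ rv μ x j (fun ω => x i ω b) + B *ᵥ rv μ x N (fun ω => x i ω b) := by
  let f : Fin d ⊕ Fin d → Fin (N + 1) × Fin d :=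
    Sum.elim (fun a => (⟨j, Nat.lt_succ_of_lt hj⟩, a)) (fun a => (⟨N, Nat.lt_succ_self N⟩, a))
  have hf : Function.Injective f := by
    rintro (a | a) (b | b) h <;> simp [f] at h ⊢ <;> first | exact h | omega
  have hsol := fun a => exists_solve hx.2.2 f hf
    (fun q => C (⟨k, Nat.lt_succ_of_le hk⟩, a) (f q))
  choose c hc using hsol
  refine ⟨fun a b => c a (Sum.inl b), fun a b => c a (Sum.inr b), ?_⟩
  rintro i (rfl | rfl) b <;> ext a
  · have := hc a (Sum.inl b)
    rw [Fintype.sum_sum_type] at this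
    simp only [rv, Pi.add_apply, mulVec, dotProduct, hx.cov hk hj.le, hx.cov hj.le hj.le,
      hx.cov le_rfl hj.le]
    exact this.symm
  · have := hc a (Sum.inr b)
    rw [Fintype.sum_sum_type] at this
    simp only [rv, Pi.add_apply, mulVec, dotProduct, hx.cov hk le_rfl, hx.cov hj.le le_rfl,
      hx.cov le_rfl le_rfl]
    exact this.symm

lemma exists_pred_zero [IsProbabilityMeasure μ] (hx : ZMNG N d μ x C) {k : ℕ} (hk : k ≤ N) :
    ∃ B : Mat d, ∀ b,
      rv μ x k (fun ω => x N ω b) = B *ᵥ rv μ x N (fun ω => x N ω b) := by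
  let f : Fin d → Fin (N + 1) × Fin d := fun a => (⟨N, Nat.lt_succ_self N⟩, a)
  have hf : Function.Injective f := by
    intro a b h
    simpa [f] using h
  have hsol := fun a => exists_solve hx.2.2 f hf
    (fun q => C (⟨k, Nat.lt_succ_of_le hk⟩, a) (f q))
  choose c hc using hsol
  refine ⟨fun a b => c a b, ?_⟩
  intro b
  ext a
  simp only [rv, mulVec, dotProduct, hx.cov hk le_rfl, hx.cov le_rfl le_rfl]
  exact (hc a b).symm

lemma mean_res [IsProbabilityMeasure μ] (hx : ZMNG N d μ x C) {k j : ℕ} (hk : k ≤ N) (hj : j ≤ N)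
    (A B : Mat d) (a : Fin d) : ∫ ω, Res N d k j A B (stack N d x ω) a ∂μ = 0 := by
  have hmv : ∀ (M : Mat d) {l : ℕ} (_ : l ≤ N) (a : Fin d),
      ∫ ω, (M *ᵥ x l ω) a ∂μ = 0 := by
    intro M l hl a
    simp only [mulVec, dotProduct]
    rw [integral_finsetSum _ (fun c _ => ((hx.memLp hl c).integrable (by norm_num)).const_mul _)]
    simp [integral_const_mul, hx.mean hl]
  have hii : ∀ {f : Ω → ℝ}, MemLp f 2 μ → Integrable f μ := fun hf => hf.integrable (by norm_num)
  have i1 := hii (hx.memLp hk a)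
  have i2 := hii (memLp_mulVec (hx.memLp hj) A a)
  have i3 := hii (memLp_mulVec (hx.memLp le_rfl) B a)
  simp only [res_stack hk hj, Pi.sub_apply]
  rw [integral_sub (f := fun ω => x k ω a - (A *ᵥ x j ω) a) (i1.sub i2) i3,
    integral_sub i1 i2, hx.mean hk, hmv A hj, hmv B le_rfl]
  simp

lemma lin_of_condEq [IsProbabilityMeasure μ] (hx : ZMNG N d μ x C) {k j : ℕ} (hk : k ≤ N)
    (hj : j < N) {S : Set ℕ} (hS : ∀ i ∈ S, i ≤ N) (hjS : j ∈ S) (hNS : N ∈ S)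
    (h : CondEq μ x k S ({j} ∪ {N})) : ∃ A B : Mat d, ∀ i ∈ S, ∀ b,
      rv μ x k (fun ω => x i ω b)
        = A *ᵥ rv μ x j (fun ω => x i ω b) + B *ᵥ rv μ x N (fun ω => x i ω b) := by
  obtain ⟨A, B, hAB⟩ := exists_pred hx hk hj
  refine ⟨A, B, fun i hi b => ?_⟩
  set T : Set ℕ := {j} ∪ {N} with hT
  have hTN : ∀ i ∈ T, i ≤ N := by
    rintro i (h | h) <;> simp at h <;> omega
  have hm := hx.1
  set w : Ω → Fin d → ℝ := fun ω => Res N d k j A B (stack N d x ω) with hw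
  have hwm : Measurable w :=
    (LinearMap.continuous_of_finiteDimensional _).measurable.comp (meas_stack hm)
  have hw2 : ∀ a, MemLp (fun ω => w ω a) 2 μ := memLp_res hx hk hj.le A B
  have hind : Indep (MeasurableSpace.comap w inferInstance) (sigmaOf x T) μ := by
    refine indep_res hx hTN _ fun i hi a b => ?_
    rw [cov_res hx hk hj.le A B a (hx.memLp (hTN i hi) b), hAB i hi b]
    simp
  have hFm := sigma_le hm hS
  have hGm := sigma_le hm hTN
  have hw0 : ∀ a, ∫ ω, w ω a ∂μ = 0 := mean_res hx hk hj.le A B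
  -- conditional mean given the small sigma-algebra
  have hcG : ∀ a, μ[fun ω => w ω a | sigmaOf x T] =ᵐ[μ] 0 := by
    intro a
    have := condExp_indep_eq (f := fun ω => w ω a) hwm.comap_le hGm
      ((measurable_pi_apply a).comp (comap_measurable w)).stronglyMeasurable hind
    refine this.trans ?_
    rw [hw0 a]
    rfl
  have hcF : ∀ a, μ[fun ω => w ω a | sigmaOf x S] =ᵐ[μ] 0 := by
    intro a
    have hxi : Integrable ((fun v : Fin d → ℝ => v a) ∘ x k) μ :=
      (hx.memLp hk a).integrable (by norm_num)
    have he := condExp_ext (hm k hk) h (f := fun v : Fin d → ℝ => v a)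
      (measurable_pi_apply a) hxi
    let q : Ω → ℝ := fun ω => (A *ᵥ x j ω + B *ᵥ x N ω) a
    have hqi : Integrable q μ := by
      refine MemLp.integrable (q := 2) (by norm_num) ?_
      exact (memLp_mulVec (hx.memLp hj.le) A a).add (memLp_mulVec (hx.memLp le_rfl) B a)
    have hqm : ∀ U : Set ℕ, j ∈ U → N ∈ U → StronglyMeasurable[sigmaOf x U] q := by
      intro U hjU hNU
      refine Measurable.stronglyMeasurable ?_
      have h1 : Measurable fun v : Fin d → ℝ => A *ᵥ v :=
        A.mulVecLin.continuous_of_finiteDimensional.measurable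
      have h2 : Measurable fun v : Fin d → ℝ => B *ᵥ v :=
        B.mulVecLin.continuous_of_finiteDimensional.measurable
      exact (measurable_pi_apply a).comp
        ((h1.comp (meas_sigma hjU)).add (h2.comp (meas_sigma hNU)))
    have hwq : (fun ω => w ω a) = (fun v : Fin d → ℝ => v a) ∘ x k - q := by
      ext ω
      simp only [hw, res_stack hk hj.le, q, Pi.sub_apply, Pi.add_apply, Function.comp]
      ring
    have hG := hcG a
    rw [hwq] at hG ⊢
    have sF := condExp_sub hxi hqi (sigmaOf x S)
    have sG := condExp_sub hxi hqi (sigmaOf x T)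
    rw [condExp_of_stronglyMeasurable hFm (hqm S hjS hNS) hqi] at sF
    rw [condExp_of_stronglyMeasurable hGm (hqm T (by simp [hT]) (by simp [hT])) hqi] at sG
    filter_upwards [sF, sG, hG, he] with ω h1 h2 h3 h4
    rw [h1, Pi.sub_apply, h4, ← Pi.sub_apply, ← h2, h3]
  -- conclusion
  ext a
  have hu := hx.memLp (hS i hi) b
  have hcov : cov[fun ω => w ω a, fun ω => x i ω b; μ] = 0 := by
    rw [covariance_eq_sub (hw2 a) hu, hw0 a, zero_mul, sub_zero]
    have h_int : Integrable ((fun ω => w ω a) * fun ω => x i ω b) μ := (hw2 a).integrable_mul hu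
    rw [← integral_condExp hFm]
    have hp := condExp_mul_of_stronglyMeasurable_right (μ := μ) (m := sigmaOf x S)
      (f := fun ω => w ω a) (g := fun ω => x i ω b)
      ((measurable_pi_apply b).comp (meas_sigma hi)).stronglyMeasurable h_int
      ((hw2 a).integrable (by norm_num))
    rw [integral_congr_ae (g := 0)]
    · simp
    · filter_upwards [hp, hcF a] with ω h1 h2
      rw [h1, Pi.mul_apply, h2]
      simp
  rw [hw, cov_res hx hk hj.le A B a hu] at hcov
  simp only [Pi.sub_apply, Pi.add_apply] at hcov ⊢
  linarith

lemma posDef_blockDiag {G : ℕ → Mat d} (hG : ∀ k, k ≤ N → (G k).PosDef) :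
    (blockDiag N d G).PosDef := by
  refine Matrix.PosDef.of_dotProduct_mulVec_pos ?_ ?_
  · ext p q
    simp only [conjTranspose_apply, blockDiag, star_trivial]
    by_cases h : (p.1 : ℕ) = (q.1 : ℕ)
    · rw [if_pos h, if_pos h.symm, ← h]
      simpa using (hG p.1 (Nat.le_of_lt_succ p.1.2)).1.apply p.2 q.2
    · rw [if_neg h, if_neg (Ne.symm h)]
  · intro v hv
    have key : star v ⬝ᵥ (blockDiag N d G *ᵥ v)
        = ∑ i : Fin (N + 1), (fun a => v (i, a)) ⬝ᵥ (G i *ᵥ fun a => v (i, a)) := by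
      simp only [dotProduct, mulVec, Fintype.sum_prod_type, blockDiag, star_trivial]
      refine Finset.sum_congr rfl fun i _ => Finset.sum_congr rfl fun a _ => ?_
      congr 1
      rw [Finset.sum_eq_single i]
      · simp
      · intro j _ hj
        have : (i : ℕ) ≠ (j : ℕ) := fun h => hj (Fin.ext h.symm)
        simp [this]
      · simp
    rw [key]
    obtain ⟨p, hp⟩ := Function.ne_iff.1 hv
    refine Finset.sum_pos' (fun i _ => ?_) ⟨p.1, Finset.mem_univ _, ?_⟩
    · simpa using (hG i (Nat.le_of_lt_succ i.2)).posSemidef.dotProduct_mulVec_nonneg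
        (fun a => v (i, a))
    · have : (fun a => v (p.1, a)) ≠ 0 := fun h => hp (congrFun h p.2)
      simpa using (hG p.1 (Nat.le_of_lt_succ p.1.2)).dotProduct_mulVec_pos this

/-- A nonzero linear functional of the stacked vector has positive variance. -/
lemma var_pos [IsProbabilityMeasure μ] (hx : ZMNG N d μ x C)
    (φ : (Fin (N + 1) × Fin d → ℝ) →ₗ[ℝ] ℝ) (hφ : φ ≠ 0) :
    0 < Var[fun ω => φ (stack N d x ω); μ] := by
  classical
  let l : Fin (N + 1) × Fin d → ℝ := fun p => φ (Pi.single p 1)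
  have hl : ∀ z, φ z = ∑ p, l p * z p := by
    intro z
    rw [φ.pi_apply_eq_sum_univ z]
    refine Finset.sum_congr rfl fun i _ => ?_
    rw [smul_eq_mul, mul_comm]
    congr 2
    ext j
    simp [Pi.single_apply, eq_comm]
  simp only [hl]
  rw [var_lin (meas_stack hx.1) hx.2.2 hx.2.1]
  have : l ≠ 0 := by
    intro h0
    apply hφ
    ext z
    simp [hl, h0]
  simpa using hx.2.2.dotProduct_mulVec_pos this

end Main

section Final

variable {N d : ℕ} {μ : Measure Ω} {x : ℕ → Ω → Fin d → ℝ}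
  {C : Matrix (Fin (N + 1) × Fin d) (Fin (N + 1) × Fin d) ℝ}

lemma forward [IsProbabilityMeasure μ] (hN : 3 ≤ N) (hx : ZMNG N d μ x C)
    (h : IsCM μ x 0 N N) : ∃ Gm GN Gcov : ℕ → Mat d, CMLModel N d μ x Gm GN Gcov := by
  have hex : ∀ k, ∃ A B : Mat d, 1 ≤ k → k < N → ∀ i, (i < k ∨ i = N) → ∀ b,
      rv μ x k (fun ω => x i ω b)
        = A *ᵥ rv μ x (k - 1) (fun ω => x i ω b) + B *ᵥ rv μ x N (fun ω => x i ω b) := by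
    intro k
    by_cases hk : 1 ≤ k ∧ k < N
    · obtain ⟨h1, h2⟩ := hk
      obtain ⟨A, B, hAB⟩ := lin_of_condEq hx (k := k) (j := k - 1) h2.le (by omega)
        (S := Set.Icc 0 (k - 1) ∪ {N})
        (by rintro i (hi | hi) <;> simp at hi <;> omega) (by simp) (by simp)
        (h (k - 1) k (Nat.zero_le _) (by omega) h2.le)
      refine ⟨A, B, fun _ _ i hi b => hAB i ?_ b⟩
      rcases hi with hi | hi
      · left
        simp
        omega
      · right
        exact hi
    · exact ⟨0, 0, fun h1 h2 => absurd ⟨h1, h2⟩ hk⟩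
  choose A0 B0 hAB using hex
  obtain ⟨B00, hB00⟩ := exists_pred_zero hx (k := 0) (Nat.zero_le _)
  let Gm : ℕ → Mat d := fun k => if 1 ≤ k ∧ k < N then A0 k else 0
  let GN : ℕ → Mat d := fun k => if k = 0 then B00 else if k < N then B0 k else 0
  have hGm0 : Gm 0 = 0 := by simp [Gm]
  have hGmN : Gm N = 0 := by simp [Gm]
  have hGNN : GN N = 0 := by
    have : N ≠ 0 := by omega
    simp [GN, this]
  have K : ∀ k, k < N → ∀ i, (i < k ∨ i = N) → ∀ b,
      rv μ x k (fun ω => x i ω b)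
        = Gm k *ᵥ rv μ x (k - 1) (fun ω => x i ω b) + GN k *ᵥ rv μ x N (fun ω => x i ω b) := by
    intro k hk i hi b
    rcases Nat.eq_zero_or_pos k with rfl | hk0
    · have hiN : i = N := by omega
      subst hiN
      rw [hGm0, hB00 b]
      simp [GN]
    · have e1 : Gm k = A0 k := by
        have : 1 ≤ k ∧ k < N := ⟨hk0, hk⟩
        simp only [Gm, if_pos this]
      have e2 : GN k = B0 k := by
        simp only [GN, if_neg hk0.ne', if_pos hk]
      rw [e1, e2]
      exact hAB k hk0 hk i hi b
  let e : ℕ → Ω → Fin d → ℝ := fun k ω => Res N d k (k - 1) (Gm k) (GN k) (stack N d x ω)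
  let Gcov : ℕ → Mat d := fun k a b => cov[fun ω => e k ω a, fun ω => e k ω b; μ]
  have hk1 : ∀ {k}, k ≤ N → k - 1 ≤ N := fun hk => by omega
  have he2 : ∀ k, k ≤ N → ∀ a, MemLp (fun ω => e k ω a) 2 μ := fun k hk a =>
    memLp_res hx hk (hk1 hk) _ _ a
  have K2 : ∀ k, k < N → ∀ i, i ≤ N → (i < k ∨ i = N) → ∀ a b,
      cov[fun ω => e k ω a, fun ω => x i ω b; μ] = 0 := by
    intro k hk i hiN hi a b
    rw [cov_res hx hk.le (hk1 hk.le) _ _ a (hx.memLp hiN b), K k hk i hi b]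
    simp
  have K3 : ∀ k l, k < N → l ≤ N → (l < k ∨ l = N) → ∀ a b,
      cov[fun ω => e k ω a, fun ω => e l ω b; μ] = 0 := by
    intro k l hk hl hkl a b
    rw [covariance_comm, cov_res hx hl (hk1 hl) _ _ b (he2 k hk.le a)]
    have r0 : ∀ i, i ≤ N → (i < k ∨ i = N) → rv μ x i (fun ω => e k ω a) = 0 := by
      intro i hiN hi
      ext c
      simp only [rv]
      rw [covariance_comm]
      exact K2 k hk i hiN hi a c
    rw [r0 l hl hkl, r0 N le_rfl (Or.inr rfl)]
    rcases hkl with hlk | rfl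
    · rw [r0 (l - 1) (hk1 hl) (by omega)]
      simp
    · rw [hGmN]
      simp
  have K4 : ∀ k l, k ≤ N → l ≤ N → k ≠ l → ∀ a b,
      cov[fun ω => e k ω a, fun ω => e l ω b; μ] = 0 := by
    intro k l hk hl hkl a b
    by_cases h1 : k < N ∧ (l < k ∨ l = N)
    · exact K3 k l h1.1 hl h1.2 a b
    · rw [covariance_comm]
      exact K3 l k (by omega) hk (by omega) b a
  have hpos : ∀ k, k ≤ N → (Gcov k).PosDef := by
    intro k hk
    refine Matrix.PosDef.of_dotProduct_mulVec_pos ?_ ?_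
    · ext a b
      rw [conjTranspose_apply, star_trivial]
      exact covariance_comm _ _
    · intro v hv
      let φ : (Fin (N + 1) × Fin d → ℝ) →ₗ[ℝ] ℝ :=
        ∑ a, v a • (LinearMap.proj a ∘ₗ Res N d k (k - 1) (Gm k) (GN k))
      have hφa : ∀ z, φ z = ∑ a, v a * Res N d k (k - 1) (Gm k) (GN k) z a := by
        intro z
        simp [φ]
      have hφ : φ ≠ 0 := by
        intro h0
        let z : Fin (N + 1) × Fin d → ℝ := fun p => if (p.1 : ℕ) = k then v p.2 else 0
        have hz : ∀ i, i ≤ N → pj N d i z = if i = k then v else 0 := by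
          intro i hi
          ext a
          have hm : i % (N + 1) = i := Nat.mod_eq_of_lt (Nat.lt_succ_of_le hi)
          rcases eq_or_ne i k with rfl | hik
          · simp [pj, z, LinearMap.funLeft, hm]
          · simp [pj, z, LinearMap.funLeft, hm, hik]
        have hr : Res N d k (k - 1) (Gm k) (GN k) z = v := by
          simp only [Res, LinearMap.sub_apply, LinearMap.comp_apply, hz k hk,
            hz (k - 1) (hk1 hk), hz N le_rfl, if_true]
          have t1 : (Gm k).mulVecLin (if k - 1 = k then v else 0) = 0 := by
            rcases Nat.eq_zero_or_pos k with rfl | hk0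
            · rw [hGm0]
              simp
            · rw [if_neg (by omega)]
              simp
          have t2 : (GN k).mulVecLin (if N = k then v else 0) = 0 := by
            by_cases hNk : N = k
            · rw [← hNk, hGNN]
              simp
            · rw [if_neg hNk]
              simp
          rw [t1, t2]
          simp
        have hzz := hφa z
        rw [h0, hr] at hzz
        have : v ⬝ᵥ v = 0 := hzz.symm
        exact hv (dotProduct_self_eq_zero.1 this)
      have hv2 := var_pos hx φ hφ
      simp only [hφa] at hv2
      have hme := he2 k hk
      have hmeas : AEMeasurable (fun ω => ∑ a, v a * e k ω a) μ :=
        (memLp_finsetSum (μ := μ) (p := 2) Finset.univ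
          (fun a _ => (hme a).const_mul (v a))).aestronglyMeasurable.aemeasurable
      have hcv : Var[fun ω => ∑ a, v a * e k ω a; μ] = star v ⬝ᵥ (Gcov k *ᵥ v) := by
        rw [← covariance_self hmeas,
          covariance_fun_sum_fun_sum (fun i => (hme i).const_mul _) (fun i => (hme i).const_mul _)]
        simp only [covariance_const_mul_left, covariance_const_mul_right]
        simp only [dotProduct, mulVec, Finset.mul_sum, star_trivial]
        refine Finset.sum_congr rfl fun i _ => Finset.sum_congr rfl fun j _ => ?_
        simp only [Gcov]
        ring
      rw [← hcv]
      exact hv2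
  refine ⟨Gm, GN, Gcov, e, ⟨?_, ?_, posDef_blockDiag hpos⟩, hpos, ?_⟩
  · intro k _
    exact (LinearMap.continuous_of_finiteDimensional _).measurable.comp (meas_stack hx.1)
  · refine zm_of_gauss ?_ ?_ ?_
    · let L : (Fin (N + 1) × Fin d → ℝ) →ₗ[ℝ] (Fin (N + 1) × Fin d → ℝ) :=
        LinearMap.pi fun p => LinearMap.proj p.2 ∘ₗ
          Res N d p.1 ((p.1 : ℕ) - 1) (Gm p.1) (GN p.1)
      exact hx.gauss.map_fun (LinearMap.toContinuousLinearMap L)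
    · intro p
      exact mean_res hx (Nat.le_of_lt_succ p.1.2) (hk1 (Nat.le_of_lt_succ p.1.2)) _ _ p.2
    · intro p q
      simp only [blockDiag, stack]
      by_cases hpq : (p.1 : ℕ) = (q.1 : ℕ)
      · rw [if_pos hpq, ← hpq]
      · rw [if_neg hpq]
        exact K4 _ _ (Nat.le_of_lt_succ p.1.2) (Nat.le_of_lt_succ q.1.2) hpq _ _
  · refine Filter.Eventually.of_forall fun ω => ⟨?_, ?_, ?_⟩
    · intro k h1 h2
      simp only [e]
      rw [res_stack (by omega) (by omega)]
      abel
    · simp only [e]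
      rw [res_stack le_rfl (by omega), hGmN, hGNN]
      simp
    · simp only [e]
      rw [res_stack (Nat.zero_le _) (by omega), hGm0]
      simp

lemma condEq_self [IsProbabilityMeasure μ] (hm : ∀ k, k ≤ N → Measurable (x k))
    {k : ℕ} (hk : k ≤ N) {S T : Set ℕ}
    (hS : ∀ i ∈ S, i ≤ N) (hT : ∀ i ∈ T, i ≤ N) (hkS : k ∈ S) (hkT : k ∈ T) :
    CondEq μ x k S T := by
  intro D hD
  have hDm : Measurable (D.indicator (fun _ => (1 : ℝ))) := measurable_const.indicator hD
  have hi : Integrable (D.indicator (fun _ => (1 : ℝ)) ∘ x k) μ := by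
    refine Integrable.of_bound (C := 1) (hDm.comp (hm k hk)).aestronglyMeasurable ?_
    refine Filter.Eventually.of_forall fun ω => ?_
    by_cases h : x k ω ∈ D <;> simp [h]
  rw [condExp_of_stronglyMeasurable (sigma_le hm hS)
      (hDm.comp (meas_sigma hkS)).stronglyMeasurable hi,
    condExp_of_stronglyMeasurable (sigma_le hm hT)
      (hDm.comp (meas_sigma hkT)).stronglyMeasurable hi]

lemma backward [IsProbabilityMeasure μ] (hN : 3 ≤ N) (hx : ZMNG N d μ x C)
    {Gm GN Gcov : ℕ → Mat d} (h : CMLModel N d μ x Gm GN Gcov) : IsCM μ x 0 N N := by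
  obtain ⟨e, he, -, hmod⟩ := h
  have hee : ∀ k l, k ≤ N → l ≤ N → k ≠ l → ∀ a b,
      cov[fun ω => e k ω a, fun ω => e l ω b; μ] = 0 := by
    intro k l hk hl hkl a b
    rw [he.cov hk hl]
    simp [blockDiag, hkl]
  -- the recursion for covariances
  have hrec : ∀ k, 1 ≤ k → k < N → ∀ u : Ω → ℝ, MemLp u 2 μ →
      rv μ x k u = Gm k *ᵥ rv μ x (k - 1) u + GN k *ᵥ rv μ x N u + rv μ e k u := by
    intro k h1 h2 u hu
    have hk1 : k - 1 ≤ N := by omega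
    ext a
    simp only [rv, Pi.add_apply]
    rw [cov_congr_left (g := fun ω => (Gm k *ᵥ x (k - 1) ω) a + (GN k *ᵥ x N ω) a + e k ω a)]
    · have m1 := memLp_mulVec (hx.memLp hk1) (Gm k) a
      have m2 := memLp_mulVec (hx.memLp le_rfl) (GN k) a
      have a1 := covariance_add_left (m1.add m2) (he.memLp h2.le a) hu
      have a2 := covariance_add_left m1 m2 hu
      rw [a2, cov_mulVec (hx.memLp hk1) _ a hu, cov_mulVec (hx.memLp le_rfl) _ a hu] at a1
      exact a1
    · filter_upwards [hmod] with ω hω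
      rw [hω.1 k h1 (by omega)]
      simp
  have hrec0 : ∀ u : Ω → ℝ, MemLp u 2 μ →
      rv μ x 0 u = GN 0 *ᵥ rv μ x N u + rv μ e 0 u := by
    intro u hu
    ext a
    simp only [rv, Pi.add_apply]
    rw [cov_congr_left (g := fun ω => (GN 0 *ᵥ x N ω) a + e 0 ω a)]
    · have m2 := memLp_mulVec (hx.memLp le_rfl) (GN 0) a
      have a1 := covariance_add_left m2 (he.memLp (Nat.zero_le _) a) hu
      rw [cov_mulVec (hx.memLp le_rfl) _ a hu] at a1
      exact a1
    · filter_upwards [hmod] with ω hω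
      rw [hω.2.2]
      simp
  have hrecN : ∀ u : Ω → ℝ, rv μ x N u = rv μ e N u := by
    intro u
    ext a
    simp only [rv]
    refine cov_congr_left ?_
    filter_upwards [hmod] with ω hω
    rw [hω.2.1]
  -- noise is uncorrelated with the past and with the final state
  have r0 : ∀ k l, k ≤ N → l ≤ N → l ≠ k → ∀ a, rv μ e l (fun ω => e k ω a) = 0 := by
    intro k l hk hl hkl a
    ext b
    exact hee l k hl hk hkl b a
  have hxe : ∀ k, k < N → ∀ a i, i < k → rv μ x i (fun ω => e k ω a) = 0 := by
    intro k hk a i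
    have hu := he.memLp hk.le a
    have hxN : rv μ x N (fun ω => e k ω a) = 0 := by
      rw [hrecN, r0 k N hk.le le_rfl (by omega)]
    induction i with
    | zero =>
      intro hi
      rw [hrec0 _ hu, hxN, r0 k 0 hk.le (Nat.zero_le _) (by omega)]
      simp
    | succ i ih =>
      intro hi
      rw [hrec (i + 1) (by omega) (by omega) _ hu, hxN, Nat.add_sub_cancel, ih (by omega),
        r0 k (i + 1) hk.le (by omega) (by omega)]
      simp
  have hex : ∀ k, k < N → ∀ i, (i < k ∨ i = N) → ∀ b, rv μ e k (fun ω => x i ω b) = 0 := by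
    intro k hk i hi b
    ext a
    simp only [rv]
    rw [covariance_comm]
    rcases hi with hi | rfl
    · exact congrFun (hxe k hk a i hi) b
    · have := congrFun (hrecN (fun ω => e k ω a)) b
      rw [r0 k i hk.le le_rfl (by omega)] at this
      exact this
  -- prediction from time `j`
  have hP : ∀ j m, j + m < N → ∃ A B : Mat d, ∀ i, i ≤ N → (i ≤ j ∨ i = N) → ∀ b,
      rv μ x (j + m) (fun ω => x i ω b)
        = A *ᵥ rv μ x j (fun ω => x i ω b) + B *ᵥ rv μ x N (fun ω => x i ω b) := by
    intro j m
    induction m with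
    | zero =>
      intro _
      exact ⟨1, 0, fun i _ _ b => by simp⟩
    | succ m ih =>
      intro hm
      obtain ⟨A, B, hAB⟩ := ih (by omega)
      refine ⟨Gm (j + (m + 1)) * A, Gm (j + (m + 1)) * B + GN (j + (m + 1)), fun i hiN hi b => ?_⟩
      rw [hrec (j + (m + 1)) (by omega) hm _ (hx.memLp hiN b),
        hex (j + (m + 1)) hm i (by omega) b,
        show j + (m + 1) - 1 = j + m by omega, hAB i hiN hi b]
      simp only [mulVec_add, add_mulVec, mulVec_mulVec, add_zero]
      abel
  intro j k _ hjk hk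
  have hSN : ∀ i ∈ Set.Icc 0 j ∪ {N}, i ≤ N := by
    rintro i (hi | hi) <;> simp at hi <;> omega
  have hTN : ∀ i ∈ ({j} ∪ {N} : Set ℕ), i ≤ N := by
    rintro i (hi | hi) <;> simp at hi <;> omega
  rcases hk.lt_or_eq with hkN | rfl
  · obtain ⟨A, B, hAB⟩ := hP j (k - j) (by omega)
    rw [show j + (k - j) = k by omega] at hAB
    refine condEq_of_cov hx (A := A) (B := B) hk (by omega : j ≤ N) hSN ?_ (by simp) (by simp) ?_
    · rintro i (hi | hi)
      · left
        simp at hi ⊢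
        omega
      · right
        exact hi
    · intro i hi b
      refine hAB i (hSN i hi) ?_ b
      rcases hi with hi | hi
      · left
        exact hi.2
      · right
        exact hi
  · exact condEq_self hx.1 le_rfl hSN hTN (by simp) (by simp)

end Final

/-- A zero-mean nonsingular Gaussian sequence `[x_k]`, `k ∈ [0,N]`,
is CM_L iff it obeys a CM_L model. -/
theorem stmt6 {N d : ℕ} (hN : 3 ≤ N) (hd : 1 ≤ d)
    (μ : Measure Ω) [IsProbabilityMeasure μ] (x : ℕ → Ω → Fin d → ℝ)
    (C : Matrix (Fin (N + 1) × Fin d) (Fin (N + 1) × Fin d) ℝ)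
    (hx : ZMNG N d μ x C) :
    IsCM μ x 0 N N ↔ ∃ Gm GN Gcov : ℕ → Mat d, CMLModel N d μ x Gm GN Gcov := by
  constructor
  · exact forward hN hx
  · rintro ⟨Gm, GN, Gcov, h⟩
    exact backward hN hx h

end CMSeqPaper
end

section
/- A zero-mean nonsingular Gaussian sequence [x_k], k ∈ [0,N], is reciprocal if and only if it obeys a CM_L model whose parameters satisfy G_k⁻¹ G_{k,N} = G_{k+1,k}' G_{k+1}⁻¹ G_{k+1,N} for all k ∈ [1,N−2]. Moreover, such a sequence [x_k] is Markov if and only if, in addition, G_0⁻¹ G_{0,N} = G_{1,0}' G_1⁻¹ G_{1,N}. -/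
open MeasureTheory ProbabilityTheory Matrix
open scoped NNReal

namespace CMSeqPaper

variable {Ω : Type*} [MeasurableSpace Ω]

section GaussianFacts

variable {ι : Type*} [Fintype ι] {μ : Measure Ω} {X : Ω → ι → ℝ} {C : Matrix ι ι ℝ}

lemma gauss_hasLaw (hX : Measurable X) (h : IsZeroMeanGaussian μ X C) : HasGaussianLaw X μ where
  isGaussian_map := by
    classical
    refine isGaussian_of_map_eq_gaussianReal fun L => ⟨0,
      ((fun i => L (Pi.single i 1)) ⬝ᵥ C *ᵥ (fun i => L (Pi.single i 1))).toNNReal, ?_⟩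
    · rw [Measure.map_map L.continuous.measurable hX]
      rw [← h (fun i => L (Pi.single i 1))]
      congr 1
      ext ω
      have : X ω = ∑ i, X ω i • (Pi.single i (1 : ℝ) : ι → ℝ) := by
        ext j
        simp [Finset.sum_apply, Pi.single_apply]
      simp only [Function.comp_apply]
      conv_lhs => rw [this]
      simp [mul_comm]

lemma dot_meas (hX : Measurable X) (l : ι → ℝ) : Measurable (fun ω => l ⬝ᵥ X ω) := by
  unfold dotProduct
  fun_prop

lemma gauss_hasLaw_dot (hX : Measurable X) (h : IsZeroMeanGaussian μ X C) {α β : Type*}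
    [Fintype α] [Fintype β] (l : α → ι → ℝ) (m : β → ι → ℝ) :
    HasGaussianLaw (fun ω => ((fun a => l a ⬝ᵥ X ω), (fun b => m b ⬝ᵥ X ω))) μ := by
  have := (gauss_hasLaw hX h).map_fun
    (LinearMap.toContinuousLinearMap ((Matrix.mulVecLin (Matrix.of l)).prod
      (Matrix.mulVecLin (Matrix.of m))))
  exact this

lemma gauss_memLp (hX : Measurable X) (h : IsZeroMeanGaussian μ X C) (l : ι → ℝ) :
    MemLp (fun ω => l ⬝ᵥ X ω) 2 μ := by
  have := (gauss_hasLaw_dot hX h (fun _ : Unit => l) (fun _ : Unit => l)).fst.memLp_two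
  exact this.eval ()

lemma gauss_mean (hX : Measurable X) (h : IsZeroMeanGaussian μ X C) (l : ι → ℝ) :
    ∫ ω, l ⬝ᵥ X ω ∂μ = 0 := by
  have h1 := h l
  have : ∫ y, y ∂(μ.map (fun ω => l ⬝ᵥ X ω)) = 0 := by
    unfold dotProduct
    rw [h1]; simp
  rwa [integral_map (dot_meas hX l).aemeasurable (by fun_prop)] at this

lemma gauss_var (hX : Measurable X) (h : IsZeroMeanGaussian μ X C) (hC : C.PosSemidef)
    (l : ι → ℝ) : Var[fun ω => l ⬝ᵥ X ω; μ] = l ⬝ᵥ C *ᵥ l := by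
  have h1 := h l
  have : Var[fun y => y; μ.map (fun ω => l ⬝ᵥ X ω)] = l ⬝ᵥ C *ᵥ l := by
    unfold dotProduct
    rw [h1, variance_fun_id_gaussianReal]
    have := hC.dotProduct_mulVec_nonneg l
    simp only [star_trivial] at this
    exact Real.coe_toNNReal _ this
  rw [← this, variance_map (by fun_prop) (dot_meas hX l).aemeasurable]
  rfl

lemma gauss_cov [IsProbabilityMeasure μ]
    (hX : Measurable X) (h : IsZeroMeanGaussian μ X C) (hC : C.PosSemidef)
    (l m : ι → ℝ) : cov[fun ω => l ⬝ᵥ X ω, fun ω => m ⬝ᵥ X ω; μ] = l ⬝ᵥ C *ᵥ m := by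
  have h1 := gauss_var hX h hC (l + m)
  have h2 : (fun ω => (l + m) ⬝ᵥ X ω) = (fun ω => l ⬝ᵥ X ω) + (fun ω => m ⬝ᵥ X ω) := by
    ext ω; simp [add_dotProduct]
  rw [h2, variance_add (gauss_memLp hX h l) (gauss_memLp hX h m), gauss_var hX h hC,
    gauss_var hX h hC] at h1
  have h3 : m ⬝ᵥ C *ᵥ l = l ⬝ᵥ C *ᵥ m := by
    have hs : Cᵀ = C := by simpa [conjTranspose_eq_transpose_of_trivial] using hC.1.eq
    rw [dotProduct_comm, ← hs, mulVec_transpose, ← dotProduct_mulVec, hs]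
  simp only [mulVec_add, add_dotProduct, dotProduct_add] at h1
  linarith

lemma gauss_int_mul [IsProbabilityMeasure μ]
    (hX : Measurable X) (h : IsZeroMeanGaussian μ X C) (hC : C.PosSemidef)
    (l m : ι → ℝ) : ∫ ω, (l ⬝ᵥ X ω) * (m ⬝ᵥ X ω) ∂μ = l ⬝ᵥ C *ᵥ m := by
  rw [← gauss_cov hX h hC, covariance_eq_sub (gauss_memLp hX h l) (gauss_memLp hX h m),
    gauss_mean hX h]
  simp

lemma gauss_indep [IsProbabilityMeasure μ]
    (hX : Measurable X) (h : IsZeroMeanGaussian μ X C) (hC : C.PosSemidef)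
    {α β : Type*} [Fintype α] [Fintype β] (l : α → ι → ℝ) (m : β → ι → ℝ)
    (hlm : ∀ a b, l a ⬝ᵥ C *ᵥ m b = 0) :
    IndepFun (fun ω a => l a ⬝ᵥ X ω) (fun ω b => m b ⬝ᵥ X ω) μ := by
  refine HasGaussianLaw.indepFun_of_covariance_eval (gauss_hasLaw_dot hX h l m) fun i j => ?_
  rw [gauss_cov hX h hC, hlm]

lemma condExp_indep_pair [IsProbabilityMeasure μ] {β γ : Type*} [MeasurableSpace β]
    [MeasurableSpace γ] [StandardBorelSpace γ] [Nonempty γ] {U : Ω → β} {R : Ω → γ}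
    (hU : Measurable U) (hR : Measurable R) (hi : IndepFun U R μ) {f : β × γ → ℝ}
    (hf : StronglyMeasurable f) (hint : Integrable (fun ω => f (U ω, R ω)) μ) :
    μ[fun ω => f (U ω, R ω) | MeasurableSpace.comap U inferInstance] =ᵐ[μ]
      fun ω => ∫ y, f (U ω, y) ∂(μ.map R) := by
  have h1 := condExp_prod_ae_eq_integral_condDistrib hU hR.aemeasurable hf hint
  have : IsProbabilityMeasure (μ.map R) := Measure.isProbabilityMeasure_map hR.aemeasurable
  have h2 : condDistrib R U μ =ᵐ[μ.map U] Kernel.const β (μ.map R) := by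
    apply condDistrib_ae_eq_of_measure_eq_compProd _ hR.aemeasurable
    rw [Measure.compProd_const]
    exact (indepFun_iff_map_prod_eq_prod_map_map hU.aemeasurable hR.aemeasurable).1 hi
  have h3 := ae_of_ae_map hU.aemeasurable h2
  filter_upwards [h1, h3] with ω e1 e2
  rw [e1, e2]
  simp

end GaussianFacts

section LinAlg

variable {ι : Type*} [Fintype ι] [DecidableEq ι] {C : Matrix ι ι ℝ}

lemma sum_supp (U : ι → Prop) [DecidablePred U] (f : ι → ℝ) (hf : ∀ q, ¬ U q → f q = 0) :
    ∑ q, f q = ∑ q : {q // U q}, f q := by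
  rw [← Finset.sum_subtype (Finset.univ.filter U) (by simp) f]
  rw [Finset.sum_filter]
  refine Finset.sum_congr rfl fun q _ => ?_
  by_cases h : U q <;> simp [h, hf]

/-- Solve a linear system with a principal submatrix of a positive definite matrix. -/
lemma solve_sub {M : Matrix ι ι ℝ} (hM : M.PosDef) (U : ι → Prop) (l : ι → ℝ) :
    ∃ v : ι → ℝ, (∀ q, ¬ U q → v q = 0) ∧ ∀ q, U q → (v ᵥ* M) q = l q := by
  classical
  set A : Matrix {q // U q} {q // U q} ℝ := M.submatrix Subtype.val Subtype.val with hA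
  have hAp : A.PosDef := hM.submatrix Subtype.val_injective
  have hu : IsUnit A.det := hAp.det_pos.ne'.isUnit
  set z : {q // U q} → ℝ := (fun q : {q // U q} => l q) ᵥ* A⁻¹ with hz
  have hzA : z ᵥ* A = fun q : {q // U q} => l q := by
    rw [hz, vecMul_vecMul, nonsing_inv_mul _ hu, vecMul_one]
  refine ⟨fun q => if h : U q then z ⟨q, h⟩ else 0, fun q hq => by simp [hq], fun q hq => ?_⟩
  have h1 := congrFun hzA ⟨q, hq⟩
  rw [← h1]
  simp only [vecMul, dotProduct]
  rw [sum_supp U _ (fun r hr => by simp [hr])]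
  refine Finset.sum_congr rfl fun r _ => ?_
  simp [r.2, hA]

/-- Linear version of conditional independence. -/
def LC (C : Matrix ι ι ℝ) (S T : ι → Prop) (p : ι) : Prop :=
  ∃ w : ι → ℝ, (∀ q, ¬ T q → w q = 0) ∧ ∀ q, S q → ((Pi.single p 1 - w) ᵥ* C) q = 0

lemma exists_proj (hC : C.PosDef) (T : ι → Prop) (p : ι) : LC C T T p := by
  obtain ⟨v, hv, hv'⟩ := solve_sub hC T ((Pi.single p 1 : ι → ℝ) ᵥ* C)
  refine ⟨v, hv, fun q hq => ?_⟩
  rw [sub_vecMul, Pi.sub_apply, hv' q hq, sub_self]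

lemma inv_zero_of_LC (hC : C.PosDef) {S T : ι → Prop}
    (h : ∀ p, ¬ S p → LC C S T p) (p q : ι) (hp : ¬ S p) (hq : S q) (hqT : ¬ T q) (hTS : ∀ q, T q → S q) :
    C⁻¹ p q = 0 := by
  classical
  have hu : IsUnit C.det := hC.det_pos.ne'.isUnit
  choose! w hw hw' using h
  set U : ι → Prop := fun p => ¬ S p with hU
  let V : Matrix {q // U q} {q // U q} ℝ := fun p q => ((Pi.single p.1 1 - w p.1) ᵥ* C) q.1
  have key : ∀ p, U p → ∀ r, ∑ u : {q // U q}, ((Pi.single p 1 - w p) ᵥ* C) u.1 * C⁻¹ u.1 r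
      = (Pi.single p 1 - w p : ι → ℝ) r := by
    intro p hp r
    have : ((Pi.single p 1 - w p) ᵥ* C) ᵥ* C⁻¹ = Pi.single p 1 - w p := by
      rw [vecMul_vecMul, mul_nonsing_inv _ hu, vecMul_one]
    have h2 := congrFun this r
    rw [← h2]
    simp only [vecMul, dotProduct]
    rw [sum_supp U]
    intro q hq
    have : S q := by simpa [hU] using hq
    have h3 := hw' p hp q this
    simp only [vecMul, dotProduct] at h3
    rw [h3, zero_mul]
  have hV : V * (C⁻¹).submatrix Subtype.val Subtype.val = 1 := by
    ext a b
    rw [Matrix.mul_apply]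
    have := key a.1 a.2 b.1
    refine this.trans ?_
    rw [Pi.sub_apply, hw a.1 a.2 b.1 (fun hT => b.2 (hTS _ hT)), sub_zero, Matrix.one_apply,
      Pi.single_apply]
    simp [Subtype.ext_iff, eq_comm]
  have hV' := mul_eq_one_comm.1 hV
  have hz : V *ᵥ (fun u : {q // U q} => C⁻¹ u.1 q) = 0 := by
    ext a
    refine (key a.1 a.2 q).trans ?_
    rw [Pi.sub_apply, hw a.1 a.2 q hqT, sub_zero, Pi.single_apply, if_neg]
    · rfl
    · rintro rfl; exact a.2 hq
  have : (fun u : {q // U q} => C⁻¹ u.1 q) = 0 := by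
    rw [← one_mulVec (fun u : {q // U q} => C⁻¹ u.1 q), ← hV', ← mulVec_mulVec, hz, mulVec_zero]
  exact congrFun this ⟨p, hp⟩

lemma LC_of_inv_zero (hC : C.PosDef) {S T : ι → Prop}
    (h : ∀ p q, ¬ S p → S q → ¬ T q → C⁻¹ p q = 0) (p : ι) (hp : ¬ S p) : LC C S T p := by
  have hu : IsUnit C.det := hC.det_pos.ne'.isUnit
  obtain ⟨v, hv, hv'⟩ := solve_sub hC.inv (fun q => ¬ S q) (Pi.single p 1)
  refine ⟨Pi.single p 1 - v ᵥ* C⁻¹, fun q hq => ?_, fun q hq => ?_⟩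
  · rw [Pi.sub_apply]
    by_cases hS : S q
    · rw [Pi.single_apply, if_neg (by rintro rfl; exact hp hS), zero_sub, neg_eq_zero]
      simp only [vecMul, dotProduct]
      refine Finset.sum_eq_zero fun r _ => ?_
      by_cases hr : S r
      · rw [hv r (by simpa using hr), zero_mul]
      · rw [h r q hr hS hq, mul_zero]
    · rw [hv' q hS, sub_self]
  · rw [sub_sub_cancel, vecMul_vecMul, nonsing_inv_mul _ hu, vecMul_one]
    exact hv q (by simpa using hq)

end LinAlg

section Bridge

variable {N d : ℕ} {μ : Measure Ω} {x : ℕ → Ω → Fin d → ℝ}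
  {C : Matrix (Fin (N + 1) × Fin d) (Fin (N + 1) × Fin d) ℝ}

lemma stack_meas (hx : ∀ k, k ≤ N → Measurable (x k)) : Measurable (stack N d x) := by
  refine measurable_pi_iff.2 fun p => ?_
  exact (measurable_pi_apply p.2).comp (hx p.1 (by have := p.1.isLt; omega))

/-- Restriction of the stacked vector to the blocks with times in `S`. -/
def restr (N d : ℕ) (x : ℕ → Ω → Fin d → ℝ) (S : Set ℕ) :
    Ω → {p : Fin (N + 1) × Fin d // (p.1 : ℕ) ∈ S} → ℝ :=
  fun ω p => stack N d x ω p.1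

lemma restr_comap (S : Set ℕ) (hS : ∀ i ∈ S, i ≤ N) :
    MeasurableSpace.comap (restr N d x S) inferInstance = sigmaOf x S := by
  apply le_antisymm
  · rw [← measurable_iff_comap_le]
    refine @measurable_pi_iff _ _ _ (sigmaOf x S) _ _ |>.2 fun p => ?_
    have h1 : @Measurable _ _ (sigmaOf x S) _ (x (p.1.1 : ℕ)) := by
      rw [measurable_iff_comap_le]
      exact le_iSup₂_of_le (p.1.1 : ℕ) p.2 le_rfl
    exact (measurable_pi_apply p.1.2).comp h1
  · refine iSup₂_le fun i hi => ?_
    rw [← measurable_iff_comap_le]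
    have hiN := hS i hi
    have : x i = (fun (u : {p : Fin (N + 1) × Fin d // (p.1 : ℕ) ∈ S} → ℝ) (a : Fin d) =>
        u ⟨(⟨i, by omega⟩, a), hi⟩) ∘ restr N d x S := rfl
    rw [this]
    refine Measurable.comp ?_ (comap_measurable _)
    exact measurable_pi_iff.2 fun a => measurable_pi_apply _

lemma restr_meas (hx : ∀ k, k ≤ N → Measurable (x k)) (S : Set ℕ) :
    Measurable (restr N d x S) :=
  measurable_pi_iff.2 fun p => (measurable_pi_apply p.1).comp (stack_meas hx)

lemma single_dot {ι : Type*} [Fintype ι] [DecidableEq ι] (p : ι) (v : ι → ℝ) :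
    (Pi.single p 1 : ι → ℝ) ⬝ᵥ v = v p := by simp

/-- Formula for the conditional law when the residual is orthogonal to the past. -/
lemma condExp_formula [IsProbabilityMeasure μ] (hx : ZMNG N d μ x C) (k : Fin (N + 1))
    (S : Set ℕ) (hS : ∀ i ∈ S, i ≤ N) (W : Fin d → (Fin (N + 1) × Fin d → ℝ))
    (hW : ∀ a q, (q.1 : ℕ) ∉ S → W a q = 0)
    (hW' : ∀ a q, (q.1 : ℕ) ∈ S → ((Pi.single (k, a) 1 - W a) ᵥ* C) q = 0)
    (A : Set (Fin d → ℝ)) (hA : MeasurableSet A) :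
    μ[A.indicator (fun _ => (1 : ℝ)) ∘ x k | sigmaOf x S] =ᵐ[μ]
      fun ω => ∫ y, A.indicator (fun _ => (1 : ℝ)) (fun a => W a ⬝ᵥ stack N d x ω + y a)
        ∂(μ.map (fun ω a => (Pi.single (k, a) 1 - W a) ⬝ᵥ stack N d x ω)) := by
  classical
  obtain ⟨hm, hg, hC⟩ := hx
  have hXm := stack_meas hm
  set R : Ω → Fin d → ℝ := fun ω a => (Pi.single (k, a) 1 - W a) ⬝ᵥ stack N d x ω with hR
  have hRm : Measurable R := measurable_pi_iff.2 fun a => dot_meas hXm _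
  have hUm := restr_meas hm S (N := N) (d := d)
  have hind : IndepFun (restr N d x S) R μ := by
    have := gauss_indep hXm hg hC.posSemidef
      (fun (b : {p : Fin (N + 1) × Fin d // (p.1 : ℕ) ∈ S}) => (Pi.single b.1 1 : _ → ℝ))
      (fun a => (Pi.single (k, a) 1 - W a)) (fun b a => by
        have hs : Cᵀ = C := by simpa [conjTranspose_eq_transpose_of_trivial] using hC.1.eq
        rw [single_dot, ← hs, mulVec_transpose]
        exact hW' a b.1 b.2)
    simp only [single_dot] at this
    exact this
  set g : ({p : Fin (N + 1) × Fin d // (p.1 : ℕ) ∈ S} → ℝ) → Fin d → ℝ :=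
    fun u a => ∑ q, W a q.1 * u q with hg
  have hgm : Measurable g := by
    refine measurable_pi_iff.2 fun a => ?_
    simp only [hg]
    fun_prop
  have hgW : ∀ ω a, g (restr N d x S ω) a = W a ⬝ᵥ stack N d x ω := by
    intro ω a
    simp only [hg, dotProduct]
    rw [sum_supp (fun q : Fin (N + 1) × Fin d => (q.1 : ℕ) ∈ S)
      (fun q => W a q * stack N d x ω q) (fun q hq => by simp [hW a q hq])]
    rfl
  have hsum : ∀ ω, x k ω = fun a => g (restr N d x S ω) a + R ω a := by
    intro ω; ext a
    rw [hgW, hR]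
    simp only [sub_dotProduct, single_dot]
    simp [stack]
  have hsm : StronglyMeasurable
      (fun p : ({p : Fin (N + 1) × Fin d // (p.1 : ℕ) ∈ S} → ℝ) × (Fin d → ℝ) =>
        A.indicator (fun _ => (1 : ℝ)) (fun a => g p.1 a + p.2 a)) := by
    have : Measurable (fun p : ({p : Fin (N + 1) × Fin d // (p.1 : ℕ) ∈ S} → ℝ) × (Fin d → ℝ) =>
        (fun a => g p.1 a + p.2 a)) := by
      refine measurable_pi_iff.2 fun a => ?_
      exact ((measurable_pi_apply a).comp (hgm.comp measurable_fst)).add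
        ((measurable_pi_apply a).comp measurable_snd)
    exact (((measurable_const).indicator hA).comp this).stronglyMeasurable
  have hint : Integrable (fun ω => A.indicator (fun _ => (1 : ℝ))
      (fun a => g (restr N d x S ω) a + R ω a)) μ := by
    refine Integrable.of_bound (C := 1)
      (hsm.measurable.comp (hUm.prodMk hRm)).aestronglyMeasurable (ae_of_all _ fun ω => ?_)
    simp only [Set.indicator]
    split_ifs <;> simp
  have := condExp_indep_pair hUm hRm hind hsm hint
  rw [restr_comap S hS] at this
  have e1 : A.indicator (fun _ => (1 : ℝ)) ∘ x k = fun ω => A.indicator (fun _ => (1 : ℝ))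
      (fun a => g (restr N d x S ω) a + R ω a) := by
    ext ω; simp only [Function.comp_apply, hsum ω]
  rw [e1]
  simpa only [hgW] using this

lemma condEq_of_LC [IsProbabilityMeasure μ] (hx : ZMNG N d μ x C) (k : Fin (N + 1))
    (S T : Set ℕ) (hS : ∀ i ∈ S, i ≤ N) (hTS : T ⊆ S)
    (h : ∀ a, LC C (fun q => (q.1 : ℕ) ∈ S) (fun q => (q.1 : ℕ) ∈ T) (k, a)) :
    CondEq μ x k S T := by
  intro A hA
  choose W hW hW' using h
  exact (condExp_formula hx k S hS W (fun a q hq => hW a q (fun h => hq (hTS h))) hW' A hA).trans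
    (condExp_formula hx k T (fun i hi => hS i (hTS hi)) W hW
      (fun a q hq => hW' a q (hTS hq)) A hA).symm

lemma LC_of_condEq [IsProbabilityMeasure μ] (hx : ZMNG N d μ x C) (k : Fin (N + 1))
    (S T : Set ℕ) (hS : ∀ i ∈ S, i ≤ N) (hTS : T ⊆ S) (h : CondEq μ x k S T) (a : Fin d) :
    LC C (fun q => (q.1 : ℕ) ∈ S) (fun q => (q.1 : ℕ) ∈ T) (k, a) := by
  classical
  obtain ⟨hm, hg, hC⟩ := hx
  have hs : Cᵀ = C := by simpa [conjTranspose_eq_transpose_of_trivial] using hC.1.eq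
  have hXm := stack_meas hm
  have hT : ∀ i ∈ T, i ≤ N := fun i hi => hS i (hTS hi)
  obtain ⟨w, hw, hw'⟩ := exists_proj hC (fun q : Fin (N + 1) × Fin d => (q.1 : ℕ) ∈ T) (k, a)
  refine ⟨w, hw, fun s hsS => ?_⟩
  obtain ⟨w₂, hw₂, hw₂'⟩ := exists_proj hC (fun q : Fin (N + 1) × Fin d => (q.1 : ℕ) ∈ T) s
  -- the residual of the state `s`
  set Z : Ω → ℝ := fun ω => (Pi.single s 1 - w₂) ⬝ᵥ stack N d x ω with hZ
  have hZ2 : MemLp Z 2 μ := gauss_memLp hXm hg _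
  have hZi : Integrable Z μ := hZ2.integrable (by norm_num)
  have hZm : Measurable Z := dot_meas hXm _
  have hZ0 : ∫ ω, Z ω ∂μ = 0 := gauss_mean hXm hg _
  have hle : ∀ S' : Set ℕ, (∀ i ∈ S', i ≤ N) → sigmaOf x S' ≤ (inferInstance : MeasurableSpace Ω) := by
    intro S' hS'
    rw [← restr_comap S' hS']
    exact (restr_meas hm S').comap_le
  have hZS : Measurable[sigmaOf x S] Z := by
    have : Z = (fun u : {p : Fin (N + 1) × Fin d // (p.1 : ℕ) ∈ S} → ℝ =>
        ∑ q, (Pi.single s 1 - w₂ : _ → ℝ) q.1 * u q) ∘ restr N d x S := by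
      ext ω
      simp only [hZ, dotProduct]
      rw [sum_supp (fun q : Fin (N + 1) × Fin d => (q.1 : ℕ) ∈ S) _ (fun q hq => by
        have h1 : q ≠ s := by rintro rfl; exact hq hsS
        rw [Pi.sub_apply, Pi.single_apply, if_neg h1, hw₂ q (fun h => hq (hTS h))]; simp)]
      rfl
    rw [this, ← restr_comap S hS]
    refine Measurable.comp ?_ (comap_measurable _)
    fun_prop
  have hindT : IndepFun (restr N d x T) Z μ := by
    have := gauss_indep hXm hg hC.posSemidef
      (fun (b : {p : Fin (N + 1) × Fin d // (p.1 : ℕ) ∈ T}) => (Pi.single b.1 1 : _ → ℝ))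
      (fun _ : Unit => (Pi.single s 1 - w₂)) (fun b _ => by
        rw [single_dot, ← hs, mulVec_transpose]
        exact hw₂' b.1 b.2)
    simp only [single_dot] at this
    exact this.comp measurable_id (measurable_pi_apply ())
  have hxk := hm k (by have := k.isLt; omega)
  have step : ∀ A : Set (Fin d → ℝ), MeasurableSet A →
      ∫ ω, (A.indicator (fun _ => (1 : ℝ)) ∘ x k) ω * Z ω ∂μ = 0 := by
    intro A hA
    set F : Ω → ℝ := A.indicator (fun _ => (1 : ℝ)) ∘ x k with hF
    have hFm : Measurable F := (measurable_const.indicator hA).comp hxk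
    have hFb : ∀ ω, ‖F ω‖ ≤ 1 := by
      intro ω
      simp only [hF, Function.comp_apply, Set.indicator]
      split_ifs <;> simp
    have hFi : Integrable F μ := Integrable.of_bound hFm.aestronglyMeasurable 1 (ae_of_all _ hFb)
    have hFZ : Integrable (F * Z) μ := by
      exact hZi.bdd_mul hFm.aestronglyMeasurable (ae_of_all _ hFb)
    have e1 : μ[F * Z | sigmaOf x S] =ᵐ[μ] μ[F | sigmaOf x S] * Z :=
      condExp_mul_of_stronglyMeasurable_right hZS.stronglyMeasurable hFZ hFi
    have e2 : ∫ ω, (F * Z) ω ∂μ = ∫ ω, (μ[F | sigmaOf x T] * Z) ω ∂μ := by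
      rw [← integral_condExp (hle S hS)]
      refine integral_congr_ae (e1.trans ?_)
      exact (h A hA).mul (Filter.EventuallyEq.refl _ _)
    refine e2.trans ?_
    have hi2 : IndepFun (μ[F | sigmaOf x T]) Z μ := by
      rw [IndepFun_iff_Indep] at hindT ⊢
      rw [restr_comap T hT] at hindT
      refine indep_of_indep_of_le_left hindT ?_
      rw [← measurable_iff_comap_le]
      exact stronglyMeasurable_condExp.measurable
    rw [hi2.integral_mul_eq_mul_integral (integrable_condExp.aestronglyMeasurable)
      hZm.aestronglyMeasurable, hZ0, mul_zero]
  have hcz : μ[Z | MeasurableSpace.comap (x k) inferInstance] =ᵐ[μ] 0 := by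
    symm
    refine ae_eq_condExp_of_forall_setIntegral_eq hxk.comap_le hZi
      (fun s _ _ => integrableOn_zero) ?_ aestronglyMeasurable_zero
    rintro _ ⟨A, hA, rfl⟩ _
    have h4 : ∫ ω in x k ⁻¹' A, Z ω ∂μ = 0 := by
      rw [← integral_indicator (hxk hA), ← step A hA]
      refine integral_congr_ae (ae_of_all _ fun ω => ?_)
      by_cases hω : x k ω ∈ A <;> simp [Set.indicator, hω]
    rw [h4]
    simp
  have hfin : ∫ ω, (x k ω a) * Z ω ∂μ = 0 := by
    have hxa : MemLp (fun ω => x k ω a) 2 μ := by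
      have := gauss_memLp hXm hg (Pi.single (k, a) 1)
      simp only [single_dot] at this
      exact this
    have e1 : μ[(fun ω => x k ω a) * Z | MeasurableSpace.comap (x k) inferInstance] =ᵐ[μ]
        (fun ω => x k ω a) * μ[Z | MeasurableSpace.comap (x k) inferInstance] :=
      condExp_mul_of_stronglyMeasurable_left
        ((measurable_pi_apply a).comp (comap_measurable (x k))).stronglyMeasurable
        (hxa.integrable_mul hZ2) hZi
    change ∫ ω, ((fun ω => x k ω a) * Z) ω ∂μ = 0
    rw [← integral_condExp hxk.comap_le]
    rw [integral_congr_ae (g := 0)]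
    · simp
    · filter_upwards [e1, hcz] with ω h1 h2
      rw [h1, Pi.mul_apply, h2]; simp
  have h0 : (Pi.single (k, a) 1 : _ → ℝ) ⬝ᵥ C *ᵥ (Pi.single s 1 - w₂) = 0 := by
    rw [← gauss_int_mul hXm hg hC.posSemidef]
    simp only [single_dot]
    exact hfin
  have h1 : w ⬝ᵥ C *ᵥ (Pi.single s 1 - w₂) = 0 := by
    rw [← hs, mulVec_transpose]
    refine Finset.sum_eq_zero fun q _ => ?_
    by_cases hq : (q.1 : ℕ) ∈ T
    · rw [hw₂' q hq, mul_zero]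
    · rw [hw q hq, zero_mul]
  have h2 : (Pi.single (k, a) 1 - w) ⬝ᵥ C *ᵥ w₂ = 0 := by
    rw [dotProduct_mulVec]
    refine Finset.sum_eq_zero fun q _ => ?_
    by_cases hq : (q.1 : ℕ) ∈ T
    · rw [hw' q hq, zero_mul]
    · rw [hw₂ q hq, mul_zero]
  have h3 : ((Pi.single (k, a) 1 - w) ᵥ* C) s = (Pi.single (k, a) 1 - w) ⬝ᵥ C *ᵥ Pi.single s 1 := by
    rw [dotProduct_mulVec]; simp
  rw [h3]
  simp only [sub_dotProduct, mulVec_sub, dotProduct_sub] at *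
  linarith

lemma condEq_iff [IsProbabilityMeasure μ] (hx : ZMNG N d μ x C) (k : Fin (N + 1))
    (S T : Set ℕ) (hS : ∀ i ∈ S, i ≤ N) (hTS : T ⊆ S) :
    CondEq μ x k S T ↔
      ∀ a, LC C (fun q => (q.1 : ℕ) ∈ S) (fun q => (q.1 : ℕ) ∈ T) (k, a) :=
  ⟨LC_of_condEq hx k S T hS hTS, condEq_of_LC hx k S T hS hTS⟩

end Bridge

section Precision

variable {N d : ℕ} {μ : Measure Ω} {x : ℕ → Ω → Fin d → ℝ}
  {C : Matrix (Fin (N + 1) × Fin d) (Fin (N + 1) × Fin d) ℝ}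

lemma inv_symm {ι : Type*} [Fintype ι] [DecidableEq ι] {C : Matrix ι ι ℝ} (hC : C.PosDef)
    (p q : ι) : C⁻¹ p q = C⁻¹ q p := by
  have h := hC.inv.1.apply p q
  simpa using h.symm

lemma cyclic_of_reciprocal [IsProbabilityMeasure μ] (hx : ZMNG N d μ x C)
    (h : IsReciprocal μ x N) : CyclicBlockTriDiag C⁻¹ := by
  have key : ∀ i j : Fin (N + 1), Far i j → 1 ≤ (i : ℕ) → (i : ℕ) + 1 ≤ N → BlockZero C⁻¹ i j := by
    intro i j hij hi1 hiN a b
    have hj := j.isLt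
    refine inv_zero_of_LC hx.2.2
      (S := fun q => (q.1 : ℕ) ∈ Set.Icc 0 ((i : ℕ) - 1) ∪ Set.Icc ((i : ℕ) + 1) N)
      (T := fun q => (q.1 : ℕ) ∈ ({(i : ℕ) - 1} ∪ {(i : ℕ) + 1} : Set ℕ)) ?_ _ _ ?_ ?_ ?_ ?_
    · rintro ⟨p, c⟩ hp
      have hpi : p = i := by
        have := p.isLt
        simp only [Set.mem_union, Set.mem_Icc] at hp
        ext; omega
      subst hpi
      refine (condEq_iff hx p _ _ ?_ ?_).1 (h _ _ _ (by omega) (by omega) (by omega)) c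
      · intro m hm
        simp only [Set.mem_union, Set.mem_Icc] at hm
        omega
      · intro m hm
        simp only [Set.mem_union, Set.mem_Icc, Set.mem_singleton_iff] at hm ⊢
        omega
    · simp only [Set.mem_union, Set.mem_Icc]; omega
    · unfold Far at hij
      simp only [Set.mem_union, Set.mem_Icc]; omega
    · unfold Far at hij
      simp only [Set.mem_union, Set.mem_singleton_iff]; omega
    · intro q
      have := q.1.isLt
      simp only [Set.mem_union, Set.mem_Icc, Set.mem_singleton_iff]; omega
  intro i j hij h1 h2
  have hi := i.isLt
  have hj := j.isLt
  by_cases hi1 : 1 ≤ (i : ℕ) ∧ (i : ℕ) + 1 ≤ N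
  · exact key i j hij hi1.1 hi1.2
  · have : BlockZero C⁻¹ j i := by
      unfold Far at hij
      refine key j i (by unfold Far; omega) (by omega) (by omega)
    intro a b
    rw [inv_symm hx.2.2]
    exact this b a

lemma reciprocal_of_cyclic [IsProbabilityMeasure μ] (hx : ZMNG N d μ x C)
    (h : CyclicBlockTriDiag C⁻¹) : IsReciprocal μ x N := by
  intro j k l hjk hkl hlN
  refine (condEq_iff hx ⟨k, by omega⟩ _ _ ?_ ?_).2 fun a => ?_
  · intro m hm
    simp only [Set.mem_union, Set.mem_Icc] at hm
    omega
  · intro m hm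
    simp only [Set.mem_union, Set.mem_Icc, Set.mem_singleton_iff] at hm ⊢
    omega
  · refine LC_of_inv_zero hx.2.2 ?_ _ ?_
    · rintro ⟨p, a⟩ ⟨q, b⟩ hp hq hqT
      have := p.isLt
      have := q.isLt
      simp only [Set.mem_union, Set.mem_Icc, Set.mem_singleton_iff] at hp hq hqT
      exact h p q (by unfold Far; omega) (by omega) (by omega) a b
    · simp only [Set.mem_union, Set.mem_Icc]; omega

lemma tri_of_markov [IsProbabilityMeasure μ] (hx : ZMNG N d μ x C)
    (h : IsMarkovOn μ x 0 N) : BlockTriDiag C⁻¹ := by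
  have key : ∀ i j : Fin (N + 1), (j : ℕ) + 2 ≤ (i : ℕ) → BlockZero C⁻¹ i j := by
    intro i j hij a b
    have hi := i.isLt
    refine inv_zero_of_LC hx.2.2
      (S := fun q => (q.1 : ℕ) ∈ Set.Icc 0 ((j : ℕ) + 1))
      (T := fun q => (q.1 : ℕ) ∈ ({(j : ℕ) + 1} : Set ℕ)) ?_ _ _ ?_ ?_ ?_ ?_
    · rintro ⟨p, c⟩ hp
      have := p.isLt
      simp only [Set.mem_Icc] at hp
      refine (condEq_iff hx p _ _ ?_ ?_).1 (h _ _ (by omega) (by omega) (by omega)) c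
      · intro m hm
        simp only [Set.mem_Icc] at hm
        omega
      · intro m hm
        simp only [Set.mem_Icc, Set.mem_singleton_iff] at hm ⊢
        omega
    · simp only [Set.mem_Icc]; omega
    · simp only [Set.mem_Icc]; omega
    · simp only [Set.mem_singleton_iff]; omega
    · intro q
      simp only [Set.mem_Icc, Set.mem_singleton_iff]; omega
  rintro i j (hij | hij)
  · intro a b
    rw [inv_symm hx.2.2]
    exact key j i hij b a
  · exact key i j hij

lemma markov_of_tri [IsProbabilityMeasure μ] (hx : ZMNG N d μ x C)
    (h : BlockTriDiag C⁻¹) : IsMarkovOn μ x 0 N := by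
  intro j k _ hjk hkN
  refine (condEq_iff hx ⟨k, by omega⟩ _ _ ?_ ?_).2 fun a => ?_
  · intro m hm
    simp only [Set.mem_Icc] at hm
    omega
  · intro m hm
    simp only [Set.mem_Icc, Set.mem_singleton_iff] at hm ⊢
    omega
  · refine LC_of_inv_zero hx.2.2 ?_ _ ?_
    · rintro ⟨p, a⟩ ⟨q, b⟩ hp hq hqT
      simp only [Set.mem_Icc, Set.mem_singleton_iff] at hp hq hqT
      exact h p q (by unfold Far; omega) a b
    · simp only [Set.mem_Icc]; omega

end Precision

section Model

variable {N d : ℕ} {μ : Measure Ω} {x : ℕ → Ω → Fin d → ℝ}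
  {C : Matrix (Fin (N + 1) × Fin d) (Fin (N + 1) × Fin d) ℝ}

/-- Block matrix with blocks `f i j`. -/
def bm (N d : ℕ) (f : ℕ → ℕ → Mat d) : Matrix (Fin (N + 1) × Fin d) (Fin (N + 1) × Fin d) ℝ :=
  fun p q => f p.1 q.1 p.2 q.2

lemma bm_mul (f g : ℕ → ℕ → Mat d) :
    bm N d f * bm N d g = bm N d (fun i j => ∑ m ∈ Finset.range (N + 1), f i m * g m j) := by
  ext p q
  rw [Matrix.mul_apply, Fintype.sum_prod_type]
  simp only [bm]
  rw [Finset.sum_range, Matrix.sum_apply]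
  rfl

lemma bm_transpose (f : ℕ → ℕ → Mat d) : (bm N d f)ᵀ = bm N d (fun i j => (f j i)ᵀ) := rfl

lemma blockDiag_eq (H : ℕ → Mat d) :
    CMSeqPaper.blockDiag N d H = bm N d (fun i j => if i = j then H i else 0) := by
  ext p q
  simp only [CMSeqPaper.blockDiag, bm]
  split_ifs <;> rfl

lemma bm_one : bm N d (fun i j => if i = j then 1 else 0) = 1 := by
  ext p q
  simp only [bm, Matrix.one_apply, Prod.ext_iff, Fin.ext_iff]
  by_cases h : (p.1 : ℕ) = q.1 <;> simp [h, Matrix.one_apply, Fin.ext_iff]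

lemma bm_mulVec (f : ℕ → ℕ → Mat d) (y : ℕ → Fin d → ℝ) (p : Fin (N + 1) × Fin d) :
    (bm N d f *ᵥ (fun q => y q.1 q.2)) p =
      ∑ m ∈ Finset.range (N + 1), (f p.1 m *ᵥ y m) p.2 := by
  simp only [mulVec, dotProduct]
  rw [Fintype.sum_prod_type, Finset.sum_range]
  rfl

/-- Inverse of a block diagonal matrix. -/
lemma blockDiag_inv (G : ℕ → Mat d) (hG : ∀ k, k ≤ N → (G k).PosDef) :
    (CMSeqPaper.blockDiag N d G)⁻¹ = CMSeqPaper.blockDiag N d (fun k => (G k)⁻¹) := by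
  apply inv_eq_right_inv
  rw [blockDiag_eq, blockDiag_eq, bm_mul, ← bm_one]
  ext p q
  simp only [bm]
  congr 2
  have hp := p.1.isLt
  rw [Finset.sum_eq_single (p.1 : ℕ)]
  · rw [if_pos rfl]
    by_cases h : (p.1 : ℕ) = q.1
    · rw [if_pos h, if_pos h, mul_nonsing_inv _ (hG _ (by omega)).det_pos.ne'.isUnit]
    · rw [if_neg h, if_neg h, mul_zero]
  · intro b _ hb
    rw [if_neg (Ne.symm hb), zero_mul]
  · intro h; simp at h; omega

/-- Blocks of the matrix expressing the noise through the states. -/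
def Lb (N : ℕ) {d : ℕ} (Gm GN : ℕ → Mat d) (i j : ℕ) : Mat d :=
  (if j = i then 1 else 0) - (if j = N ∧ i < N then GN i else 0)
    - (if j + 1 = i ∧ i < N then Gm i else 0)

lemma Lb_mulVec (Gm GN : ℕ → Mat d) (y : ℕ → Fin d → ℝ) (p : Fin (N + 1) × Fin d) :
    (bm N d (Lb N Gm GN) *ᵥ (fun q => y q.1 q.2)) p =
      (y p.1 - (if (p.1 : ℕ) < N then GN p.1 *ᵥ y N else 0)
        - (if 1 ≤ (p.1 : ℕ) ∧ (p.1 : ℕ) < N then Gm p.1 *ᵥ y (p.1 - 1) else 0)) p.2 := by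
  rw [bm_mulVec]
  have hp := p.1.isLt
  generalize (p.1 : ℕ) = i at *
  have : ∑ m ∈ Finset.range (N + 1), Lb N Gm GN i m *ᵥ y m =
      (y i - (if i < N then GN i *ᵥ y N else 0)
        - (if 1 ≤ i ∧ i < N then Gm i *ᵥ y (i - 1) else 0)) := by
    simp only [Lb, sub_mulVec, Finset.sum_sub_distrib]
    congr 1
    · congr 1
      · rw [Finset.sum_eq_single i]
        · simp
        · intro b _ hb; simp [hb]
        · intro h; simp at h; omega
      · rw [Finset.sum_eq_single N]
        · by_cases h : i < N <;> simp [h]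
        · intro b _ hb; simp [hb]
        · intro h; simp at h
    · by_cases h : 1 ≤ i ∧ i < N
      · rw [Finset.sum_eq_single (i - 1)]
        · rw [if_pos h, if_pos ⟨by omega, h.2⟩]
        · intro b _ hb; rw [if_neg (by omega), zero_mulVec]
        · intro h; simp at h; omega
      · rw [if_neg h]
        refine Finset.sum_eq_zero fun b _ => ?_
        rw [if_neg (by omega), zero_mulVec]
  rw [← this, Finset.sum_apply]

/-- Blocks of `L' H L`. -/
lemma prec_block (Gm GN H : ℕ → Mat d) (i j : ℕ) (hi : i < N) :
    ∑ m ∈ Finset.range (N + 1), (Lb N Gm GN m i)ᵀ * H m * Lb N Gm GN m j =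
      H i * Lb N Gm GN i j -
        (if i + 1 < N then (Gm (i + 1))ᵀ * H (i + 1) * Lb N Gm GN (i + 1) j else 0) := by
  have h1 : ∀ m, Lb N Gm GN m i = (if i = m then 1 else 0) -
      (if i + 1 = m ∧ m < N then Gm m else 0) := by
    intro m
    rw [Lb, if_neg (c := i = N ∧ m < N) (by omega), sub_zero]
  simp only [h1, transpose_sub, sub_mul, Finset.sum_sub_distrib]
  congr 1
  · rw [Finset.sum_eq_single i]
    · simp
    · intro b _ hb; simp [Ne.symm hb]
    · intro h; simp at h; omega
  · rw [Finset.sum_eq_single (i + 1)]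
    · by_cases h : i + 1 < N <;> simp [h]
    · intro b _ hb; simp [Ne.symm hb]
    · intro h; simp at h; omega

lemma cov_of_model [IsProbabilityMeasure μ] (hx : ZMNG N d μ x C) {Gm GN Gcov : ℕ → Mat d}
    (h : CMLModel N d μ x Gm GN Gcov) :
    bm N d (Lb N Gm GN) * C * (bm N d (Lb N Gm GN))ᵀ = CMSeqPaper.blockDiag N d Gcov := by
  obtain ⟨e, he, -, hmod⟩ := h
  set L := bm N d (Lb N Gm GN) with hL
  have hae : ∀ᵐ ω ∂μ, stack N d e ω = L *ᵥ stack N d x ω := by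
    filter_upwards [hmod] with ω hω
    obtain ⟨h1, h2, h3⟩ := hω
    ext p
    have hp := p.1.isLt
    have := Lb_mulVec Gm GN (fun k => x k ω) p
    refine Eq.trans ?_ this.symm
    simp only [stack]
    congr 1
    by_cases hN : (p.1 : ℕ) = N
    · rw [if_neg (by omega), if_neg (by omega), hN, h2]; simp
    by_cases h0 : (p.1 : ℕ) = 0
    · rw [if_pos (by omega), if_neg (by omega), h0, h3]; simp
    · rw [if_pos (by omega), if_pos (by omega), h1 p.1 (by omega) (by omega)]
      simp only [Pi.sub_apply, Pi.add_apply]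
      ring
  have hXm := stack_meas hx.1
  have hEm := stack_meas he.1
  ext p q
  have e1 := gauss_int_mul hEm he.2.1 he.2.2.posSemidef (Pi.single p 1) (Pi.single q 1)
  have e2 := gauss_int_mul hXm hx.2.1 hx.2.2.posSemidef
    ((Pi.single p 1 : _ → ℝ) ᵥ* L) ((Pi.single q 1 : _ → ℝ) ᵥ* L)
  have e3 : ∫ ω, ((Pi.single p 1 : _ → ℝ) ⬝ᵥ stack N d e ω) *
      ((Pi.single q 1 : _ → ℝ) ⬝ᵥ stack N d e ω) ∂μ =
      ∫ ω, (((Pi.single p 1 : _ → ℝ) ᵥ* L) ⬝ᵥ stack N d x ω) *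
      (((Pi.single q 1 : _ → ℝ) ᵥ* L) ⬝ᵥ stack N d x ω) ∂μ := by
    refine integral_congr_ae ?_
    filter_upwards [hae] with ω hω
    rw [hω, dotProduct_mulVec, dotProduct_mulVec]
  rw [e1, e2] at e3
  have e4 : (Pi.single p 1 : _ → ℝ) ⬝ᵥ CMSeqPaper.blockDiag N d Gcov *ᵥ Pi.single q 1 =
      CMSeqPaper.blockDiag N d Gcov p q := by
    rw [single_dot, mulVec_single_one]; rfl
  have e5 : (L * C * Lᵀ) p q = (Pi.single p 1 : _ → ℝ) ⬝ᵥ (L * C * Lᵀ) *ᵥ Pi.single q 1 := by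
    rw [single_dot, mulVec_single_one]; rfl
  rw [e5, ← e4, e3, ← mulVec_transpose L (Pi.single q 1), ← mulVec_mulVec, ← mulVec_mulVec,
    dotProduct_mulVec]

lemma prec_of_model [IsProbabilityMeasure μ] (hx : ZMNG N d μ x C) {Gm GN Gcov : ℕ → Mat d}
    (h : CMLModel N d μ x Gm GN Gcov) (i j : Fin (N + 1)) (hi : (i : ℕ) < N) (a b : Fin d) :
    C⁻¹ (i, a) (j, b) = ((Gcov i)⁻¹ * Lb N Gm GN i j -
        (if (i : ℕ) + 1 < N then (Gm (i + 1))ᵀ * (Gcov (i + 1))⁻¹ * Lb N Gm GN (i + 1) j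
          else 0)) a b := by
  have h1 := cov_of_model hx h
  obtain ⟨e, he, hG, -⟩ := h
  set L := bm N d (Lb N Gm GN) with hL
  have hu : IsUnit (CMSeqPaper.blockDiag N d Gcov).det := he.2.2.det_pos.ne'.isUnit
  have h2 : L * (C * Lᵀ * (CMSeqPaper.blockDiag N d Gcov)⁻¹) = 1 := by
    rw [← mul_assoc, ← mul_assoc, h1, mul_nonsing_inv _ hu]
  have h3 := mul_eq_one_comm.1 h2
  have h4 : C⁻¹ = Lᵀ * (CMSeqPaper.blockDiag N d Gcov)⁻¹ * L := by
    apply inv_eq_right_inv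
    rw [← h3]
    simp only [mul_assoc]
  rw [h4, blockDiag_inv _ hG, blockDiag_eq, hL, bm_transpose, bm_mul, bm_mul]
  rw [← prec_block Gm GN (fun k => (Gcov k)⁻¹) i j hi]
  simp only [bm]
  refine congrArg (fun M : Mat d => M a b) ?_
  refine Finset.sum_congr rfl fun m hm => ?_
  refine congrArg (fun M : Mat d => M * Lb N Gm GN m j) ?_
  rw [Finset.sum_eq_single m]
  · simp
  · intro b _ hb; simp [hb]
  · intro h; exact absurd hm h

lemma prec_zero [IsProbabilityMeasure μ] (hx : ZMNG N d μ x C) {Gm GN Gcov : ℕ → Mat d}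
    (h : CMLModel N d μ x Gm GN Gcov) (i j : Fin (N + 1)) (hij : (i : ℕ) + 2 ≤ j)
    (hj : (j : ℕ) < N) : BlockZero C⁻¹ i j := by
  intro a b
  rw [prec_of_model hx h i j (by omega)]
  have h1 : Lb N Gm GN i j = 0 := by
    rw [Lb, if_neg (by omega), if_neg (by omega), if_neg (by omega)]; simp
  have h2 : Lb N Gm GN (i + 1) j = 0 := by
    rw [Lb, if_neg (by omega), if_neg (by omega), if_neg (by omega)]; simp
  rw [h1, h2]; simp

lemma prec_last [IsProbabilityMeasure μ] (hx : ZMNG N d μ x C) {Gm GN Gcov : ℕ → Mat d}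
    (h : CMLModel N d μ x Gm GN Gcov) (k : ℕ) (hk : k + 2 ≤ N) :
    (BlockZero C⁻¹ ⟨k, by omega⟩ ⟨N, by omega⟩ ↔
      (Gcov k)⁻¹ * GN k = (Gm (k + 1))ᵀ * (Gcov (k + 1))⁻¹ * GN (k + 1)) := by
  have h1 : Lb N Gm GN k N = - GN k := by
    rw [Lb, if_neg (by omega), if_pos (by omega), if_neg (by omega)]; simp
  have h2 : Lb N Gm GN (k + 1) N = - GN (k + 1) := by
    rw [Lb, if_neg (by omega), if_pos (by omega), if_neg (by omega)]; simp
  have key : ∀ a b, C⁻¹ (⟨k, by omega⟩, a) (⟨N, by omega⟩, b) =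
      ((Gm (k + 1))ᵀ * (Gcov (k + 1))⁻¹ * GN (k + 1) - (Gcov k)⁻¹ * GN k) a b := by
    intro a b
    rw [prec_of_model hx h _ _ (by simp only; omega)]
    simp only
    rw [if_pos (by omega), h1, h2]
    simp only [mul_neg, Matrix.sub_apply, Matrix.neg_apply]
    ring
  constructor
  · intro hz
    ext a b
    have := key a b
    rw [hz a b, Matrix.sub_apply] at this
    linarith
  · intro heq a b
    rw [key a b, heq, sub_self]; rfl

lemma cyclic_iff [IsProbabilityMeasure μ] (hx : ZMNG N d μ x C) {Gm GN Gcov : ℕ → Mat d}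
    (h : CMLModel N d μ x Gm GN Gcov) :
    CyclicBlockTriDiag C⁻¹ ↔ ∀ k, 1 ≤ k → k ≤ N - 2 →
      (Gcov k)⁻¹ * GN k = (Gm (k + 1))ᵀ * (Gcov (k + 1))⁻¹ * GN (k + 1) := by
  constructor
  · intro hc k hk1 hk2
    rw [← prec_last hx h k (by omega)]
    exact hc _ _ (by unfold Far; simp only; omega) (by simp only; omega) (by simp only; omega)
  · intro hk
    have key : ∀ i j : Fin (N + 1), (i : ℕ) + 2 ≤ j → ¬ ((i : ℕ) = 0 ∧ (j : ℕ) = N) →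
        BlockZero C⁻¹ i j := by
      intro i j hij h0
      have hj' := j.isLt
      by_cases hj : (j : ℕ) < N
      · exact prec_zero hx h i j hij hj
      · have : j = ⟨N, Nat.lt_succ_self N⟩ := by ext; simp only; omega
        rw [this]
        exact (prec_last hx h i (by omega)).2 (hk i (by omega) (by omega))
    rintro i j (hij | hij) h1 h2
    · exact key i j hij (by omega)
    · intro a b
      rw [inv_symm hx.2.2]
      exact key j i hij (by omega) b a

lemma tri_iff [IsProbabilityMeasure μ] (hx : ZMNG N d μ x C) {Gm GN Gcov : ℕ → Mat d}
    (hN : 2 ≤ N) (h : CMLModel N d μ x Gm GN Gcov) (hc : CyclicBlockTriDiag C⁻¹) :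
    BlockTriDiag C⁻¹ ↔ (Gcov 0)⁻¹ * GN 0 = (Gm 1)ᵀ * (Gcov 1)⁻¹ * GN 1 := by
  rw [← prec_last hx h 0 (by omega)]
  constructor
  · intro ht
    exact ht _ _ (by unfold Far; simp only; omega)
  · intro h0
    have key : ∀ i j : Fin (N + 1), (i : ℕ) = 0 → (j : ℕ) = N → BlockZero C⁻¹ i j := by
      intro i j hi hj
      have e1 : i = ⟨0, Nat.succ_pos N⟩ := by ext; exact hi
      have e2 : j = ⟨N, Nat.lt_succ_self N⟩ := by ext; exact hj
      rw [e1, e2]; exact h0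
    intro i j hij
    by_cases h1 : (i : ℕ) = 0 ∧ (j : ℕ) = N
    · exact key i j h1.1 h1.2
    by_cases h2 : (i : ℕ) = N ∧ (j : ℕ) = 0
    · intro a b
      rw [inv_symm hx.2.2]
      exact key j i h2.2 h2.1 b a
    · exact hc i j hij h1 h2

end Model
section Exists

variable {N d : ℕ} {μ : Measure Ω} {x : ℕ → Ω → Fin d → ℝ}
  {C : Matrix (Fin (N + 1) × Fin d) (Fin (N + 1) × Fin d) ℝ}

lemma exists_w [IsProbabilityMeasure μ] (hx : ZMNG N d μ x C) (hr : IsReciprocal μ x N)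
    (p : Fin (N + 1) × Fin d) (hp : (p.1 : ℕ) < N) :
    ∃ w : Fin (N + 1) × Fin d → ℝ,
      (∀ q, ¬((q.1 : ℕ) + 1 = p.1 ∨ (q.1 : ℕ) = N) → w q = 0) ∧
      ∀ q, ((q.1 : ℕ) < p.1 ∨ (q.1 : ℕ) = N) → ((Pi.single p 1 - w) ᵥ* C) q = 0 := by
  by_cases h0 : (p.1 : ℕ) = 0
  · obtain ⟨w, h1, h2⟩ := exists_proj hx.2.2 (fun q => (q.1 : ℕ) = N) p
    exact ⟨w, fun q hq => h1 q (by tauto), fun q hq => h2 q (by omega)⟩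
  · have h := hr (p.1 - 1) p.1 N (by omega) hp le_rfl
    rw [condEq_iff hx p.1 _ _ ?_ ?_] at h
    · obtain ⟨w, h1, h2⟩ := h p.2
      refine ⟨w, fun q hq => h1 q ?_, fun q hq => h2 q ?_⟩
      · simp only [Set.mem_union, Set.mem_singleton_iff]; omega
      · simp only [Set.mem_union, Set.mem_Icc]; omega
    · intro i hi
      simp only [Set.mem_union, Set.mem_Icc] at hi; omega
    · intro i hi
      simp only [Set.mem_union, Set.mem_Icc, Set.mem_singleton_iff] at hi ⊢; omega

lemma Lb_inj (Gm GN : ℕ → Mat d) : Function.Injective (bm N d (Lb N Gm GN)).mulVec := by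
  have key : ∀ v, bm N d (Lb N Gm GN) *ᵥ v = 0 → v = 0 := by
    intro v hv
    set y : ℕ → Fin d → ℝ := fun k a =>
      if h : k < N + 1 then v (⟨k, h⟩, a) else 0 with hy
    have hvy : v = fun q => y q.1 q.2 := by
      ext q; simp only [hy, dif_pos q.1.isLt]
    have hL : ∀ k, k ≤ N → y k = (if k < N then GN k *ᵥ y N else 0)
        + (if 1 ≤ k ∧ k < N then Gm k *ᵥ y (k - 1) else 0) := by
      intro k hk
      ext a
      have := Lb_mulVec Gm GN y (⟨k, Nat.lt_succ_of_le hk⟩, a)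
      rw [← hvy, hv] at this
      simp only [Pi.zero_apply, Pi.sub_apply] at this
      rw [Pi.add_apply]
      linarith
    have hyN : y N = 0 := by
      rw [hL N le_rfl, if_neg (by omega), if_neg (by omega), add_zero]
    have hall : ∀ k, k ≤ N → y k = 0 := by
      intro k
      induction k with
      | zero =>
        intro hk
        rw [hL 0 hk, hyN]
        simp
      | succ k ih =>
        intro hk
        rw [hL _ hk, hyN, Nat.add_sub_cancel, ih (by omega)]
        simp
    rw [hvy]
    ext q
    have := q.1.isLt
    rw [hall _ (by omega)]; rfl
  intro u v huv
  have := key (u - v) (by rw [mulVec_sub]; exact sub_eq_zero.2 huv)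
  exact sub_eq_zero.1 this

lemma exists_model [IsProbabilityMeasure μ] (hx : ZMNG N d μ x C) (hr : IsReciprocal μ x N)
    (hN0 : 0 < N) :
    ∃ Gm GN Gcov : ℕ → Mat d, CMLModel N d μ x Gm GN Gcov := by
  choose! w hw1 hw2 using exists_w hx hr
  let Gm : ℕ → Mat d := fun k a b => if h : k < N + 1 then
    w (⟨k, h⟩, a) (⟨k - 1, by omega⟩, b) else 0
  let GN : ℕ → Mat d := fun k a b => if h : k < N + 1 then
    w (⟨k, h⟩, a) (⟨N, Nat.lt_succ_self N⟩, b) else 0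
  set L := bm N d (Lb N Gm GN) with hL
  have hrow : ∀ p : Fin (N + 1) × Fin d, (p.1 : ℕ) < N → L p = Pi.single p 1 - w p := by
    rintro ⟨⟨k, hk⟩, a⟩ hp
    ext ⟨⟨m, hm⟩, b⟩
    simp only at hp
    have hs : (Pi.single ((⟨k, hk⟩, a) : Fin (N + 1) × Fin d) (1 : ℝ) :
        Fin (N + 1) × Fin d → ℝ) (⟨m, hm⟩, b) = (if m = k then (1 : Mat d) else 0) a b := by
      rw [Pi.single_apply]
      by_cases h : m = k
      · subst h
        simp [Matrix.one_apply, eq_comm]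
      · simp [h]
    rw [Pi.sub_apply, hs]
    simp only [hL, bm, Lb, Matrix.sub_apply]
    have hz := hw1 (⟨k, hk⟩, a) hp (⟨m, hm⟩, b)
    simp only at hz
    by_cases h1 : m = N
    · subst h1
      rw [if_pos (c := m = m ∧ k < m) ⟨rfl, hp⟩, if_neg (c := m + 1 = k ∧ k < m) (by omega)]
      simp only [GN, dif_pos hk, Matrix.zero_apply, sub_zero]
    · rw [if_neg (c := m = N ∧ k < N) (by omega)]
      by_cases h2 : m + 1 = k
      · subst h2
        rw [if_pos (c := m + 1 = m + 1 ∧ m + 1 < N) ⟨rfl, hp⟩]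
        simp only [Gm, dif_pos hk, Matrix.zero_apply, sub_zero, Nat.add_sub_cancel]
      · rw [if_neg (c := m + 1 = k ∧ k < N) (by omega), hz (by omega)]
        simp
  have hrowN : ∀ p : Fin (N + 1) × Fin d, (p.1 : ℕ) = N → ∀ r : Fin (N + 1) × Fin d,
      (r.1 : ℕ) ≠ N → L p r = 0 := by
    intro p hp r hr
    simp only [hL, bm, Lb]
    rw [if_neg (by omega), if_neg (by omega), if_neg (by omega)]
    simp
  have hsupp : ∀ q r : Fin (N + 1) × Fin d, ¬ ((r.1 : ℕ) ≤ q.1 ∨ (r.1 : ℕ) = N) →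
      L q r = 0 := by
    intro q r hqr
    have h1 := q.1.isLt
    have h2 := r.1.isLt
    rw [hrow q (by omega), Pi.sub_apply, hw1 q (by omega) r (by omega), Pi.single_apply,
      if_neg, sub_zero]
    rintro rfl
    omega
  have hoff : ∀ p q : Fin (N + 1) × Fin d, (p.1 : ℕ) < N →
      ((q.1 : ℕ) < p.1 ∨ (q.1 : ℕ) = N) → (L * C * Lᵀ) p q = 0 := by
    intro p q hp hq
    have e : (L * C * Lᵀ) p q = ∑ r, (L p ᵥ* C) r * L q r := rfl
    rw [e]
    refine Finset.sum_eq_zero fun r _ => ?_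
    by_cases h : (r.1 : ℕ) < p.1 ∨ (r.1 : ℕ) = N
    · rw [hrow p hp, hw2 p hp r h, zero_mul]
    · rcases hq with hq | hq
      · rw [hsupp q r (by omega), mul_zero]
      · rw [hrowN q hq r (by omega), mul_zero]
  have hCs : Cᵀ = C := by
    have := hx.2.2.isHermitian.eq
    rwa [conjTranspose_eq_transpose_of_trivial] at this
  have hsym : (L * C * Lᵀ)ᵀ = L * C * Lᵀ := by
    rw [transpose_mul, transpose_mul, transpose_transpose, hCs, mul_assoc]
  have hoff' : ∀ p q : Fin (N + 1) × Fin d, (p.1 : ℕ) ≠ q.1 → (L * C * Lᵀ) p q = 0 := by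
    intro p q hpq
    have h1 := q.1.isLt
    have h2 := p.1.isLt
    by_cases h : (p.1 : ℕ) < N ∧ ((q.1 : ℕ) < p.1 ∨ (q.1 : ℕ) = N)
    · exact hoff p q h.1 h.2
    · rw [← hsym]
      exact hoff q p (by omega) (by omega)
  let Gcov : ℕ → Mat d := fun k a b => if h : k < N + 1 then
    (L * C * Lᵀ) (⟨k, h⟩, a) (⟨k, h⟩, b) else 0
  have hD : CMSeqPaper.blockDiag N d Gcov = L * C * Lᵀ := by
    ext p q
    simp only [CMSeqPaper.blockDiag]
    split_ifs with h
    · obtain ⟨⟨k, hk⟩, a⟩ := p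
      obtain ⟨⟨m, hm⟩, b⟩ := q
      simp only at h
      subst h
      simp only [Gcov, dif_pos hk]
    · rw [hoff' p q h]
  have hLu : IsUnit L := mulVec_injective_iff_isUnit.1 (Lb_inj Gm GN)
  have hDpos : (L * C * Lᵀ).PosDef := by
    rw [← conjTranspose_eq_transpose_of_trivial]
    exact hx.2.2.mul_mul_conjTranspose_same (vecMul_injective_iff_isUnit.2 hLu)
  let e : ℕ → Ω → Fin d → ℝ := fun k ω a => if h : k < N + 1 then
    (L *ᵥ stack N d x ω) (⟨k, h⟩, a) else 0
  have hst : ∀ ω, stack N d e ω = L *ᵥ stack N d x ω := by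
    intro ω
    ext p
    simp only [stack, e, dif_pos p.1.isLt]
  have hXm := stack_meas hx.1
  have heq : ∀ ω k a, k ≤ N → e k ω a = (x k ω - (if k < N then GN k *ᵥ x N ω else 0)
        - (if 1 ≤ k ∧ k < N then Gm k *ᵥ x (k - 1) ω else 0)) a := by
    intro ω k a hk
    have := Lb_mulVec Gm GN (fun k => x k ω) (⟨k, Nat.lt_succ_of_le hk⟩, a)
    simp only [e]
    rw [dif_pos (by omega)]
    exact this
  refine ⟨Gm, GN, Gcov, e, ⟨?_, ?_, ?_⟩, ?_, ?_⟩
  · intro k hk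
    refine measurable_pi_lambda _ fun a => ?_
    simp only [e, dif_pos (Nat.lt_succ_of_le hk)]
    simp only [mulVec, dotProduct]
    refine Finset.measurable_sum _ fun q _ => ?_
    exact ((measurable_pi_apply q).comp hXm).const_mul _
  · intro l
    rw [hD]
    have h1 := hx.2.1 (l ᵥ* L)
    have h2 : (fun ω => ∑ i, l i * stack N d e ω i) =
        fun ω => ∑ i, (l ᵥ* L) i * stack N d x ω i := by
      funext ω
      rw [hst]
      exact dotProduct_mulVec l L (stack N d x ω)
    rw [h2, h1]
    congr 2
    rw [← mulVec_transpose L l, ← mulVec_mulVec, ← mulVec_mulVec, dotProduct_mulVec l L]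
    rw [mulVec_transpose]
  · rw [hD]; exact hDpos
  · intro k hk
    have := hDpos.submatrix (e := fun a : Fin d => ((⟨k, Nat.lt_succ_of_le hk⟩, a) :
      Fin (N + 1) × Fin d)) (fun a b h => (Prod.ext_iff.1 h).2)
    convert this using 1
    ext a b
    simp only [Gcov, dif_pos (Nat.lt_succ_of_le hk)]
    rfl
  · refine Filter.Eventually.of_forall fun ω => ⟨?_, ?_, ?_⟩
    · intro k hk1 hk2
      ext a
      rw [Pi.add_apply, heq ω k a (by omega), if_pos (by omega), if_pos (by omega)]
      simp only [Pi.sub_apply, Pi.add_apply]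
      ring
    · ext a
      rw [heq ω N a le_rfl, if_neg (by omega), if_neg (by omega)]
      simp
    · ext a
      rw [Pi.add_apply, heq ω 0 a (by omega), if_neg (c := 1 ≤ 0 ∧ 0 < N) (by omega), if_pos hN0]
      simp

end Exists

/-- A zero-mean nonsingular Gaussian sequence `[x_k]`, `k ∈ [0,N]`,
is reciprocal iff it obeys a CM_L model whose parameters satisfy
`G_k⁻¹ G_{k,N} = G_{k+1,k}' G_{k+1}⁻¹ G_{k+1,N}` for all `k ∈ [1,N-2]`. Moreover,
such a sequence is Markov iff in addition `G_0⁻¹ G_{0,N} = G_{1,0}' G_1⁻¹ G_{1,N}`. -/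
theorem stmt7 {N d : ℕ} (hN : 3 ≤ N) (hd : 1 ≤ d)
    (μ : Measure Ω) [IsProbabilityMeasure μ] (x : ℕ → Ω → Fin d → ℝ)
    (C : Matrix (Fin (N + 1) × Fin d) (Fin (N + 1) × Fin d) ℝ)
    (hx : ZMNG N d μ x C) :
    (IsReciprocal μ x N ↔
      ∃ Gm GN Gcov : ℕ → Mat d,
        CMLModel N d μ x Gm GN Gcov ∧
        ∀ k, 1 ≤ k → k ≤ N - 2 →
          (Gcov k)⁻¹ * GN k = (Gm (k + 1))ᵀ * (Gcov (k + 1))⁻¹ * GN (k + 1)) ∧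
    (∀ Gm GN Gcov : ℕ → Mat d,
      CMLModel N d μ x Gm GN Gcov →
      (∀ k, 1 ≤ k → k ≤ N - 2 →
        (Gcov k)⁻¹ * GN k = (Gm (k + 1))ᵀ * (Gcov (k + 1))⁻¹ * GN (k + 1)) →
      (IsMarkovOn μ x 0 N ↔
        (Gcov 0)⁻¹ * GN 0 = (Gm 1)ᵀ * (Gcov 1)⁻¹ * GN 1)) := by
  refine ⟨⟨fun h => ?_, ?_⟩, ?_⟩
  · obtain ⟨Gm, GN, Gcov, hm⟩ := exists_model hx h (by omega)
    exact ⟨Gm, GN, Gcov, hm, (cyclic_iff hx hm).1 (cyclic_of_reciprocal hx h)⟩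
  · rintro ⟨Gm, GN, Gcov, hm, hc⟩
    exact reciprocal_of_cyclic hx ((cyclic_iff hx hm).2 hc)
  · intro Gm GN Gcov hm hc
    have cyc := (cyclic_iff hx hm).2 hc
    exact ⟨fun h => (tri_iff hx (by omega) hm cyc).1 (tri_of_markov hx h),
      fun h => markov_of_tri hx ((tri_iff hx (by omega) hm cyc).2 h)⟩

end CMSeqPaper
end

section
/- A zero-mean nonsingular Gaussian sequence [y_k], k ∈ [0,N], is Markov if and only if it obeys a Markov model: there exist d×d matrices M_{k,k−1} for k ∈ [1,N] and zero-mean jointly Gaussian, mutually uncorrelated random vectors e_k, k ∈ [0,N], with positive definite covariances M_k = Cov(e_k), such that y_0 = e_0 and y_k = M_{k,k−1} y_{k−1} + e_k for all k ∈ [1,N]. -/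
open MeasureTheory ProbabilityTheory Matrix
open scoped NNReal

namespace CMSeqPaper

variable {Ω : Type*} [MeasurableSpace Ω]

section Helpers

lemma condExp_add_indep_aux {Ω' β : Type*} {d : ℕ} {mβ : MeasurableSpace β}
    {mΩ : MeasurableSpace Ω'} (μ : Measure Ω')
    [IsProbabilityMeasure μ] (Z : Ω' → β) (Φ : β → Fin d → ℝ) (W : Ω' → Fin d → ℝ)
    (hZ : Measurable Z) (hΦ : Measurable Φ) (hW : Measurable W)
    (hind : IndepFun Z W μ)
    (A : Set (Fin d → ℝ)) (hA : MeasurableSet A) :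
    μ[fun ω => A.indicator (fun _ => (1 : ℝ)) (Φ (Z ω) + W ω) | mβ.comap Z]
      =ᵐ[μ] fun ω => ∫ w, A.indicator (fun _ => (1 : ℝ)) (Φ (Z ω) + w) ∂(μ.map W) := by
  have hprob : IsProbabilityMeasure (μ.map W) := Measure.isProbabilityMeasure_map hW.aemeasurable
  have hcd := (condDistrib_ae_eq_iff_measure_eq_compProd (μ := μ) (Y := W) Z
    hW.aemeasurable (Kernel.const _ (μ.map W))).2 (by
      rw [Measure.compProd_const]
      exact (indepFun_iff_map_prod_eq_prod_map_map
        hZ.aemeasurable hW.aemeasurable).1 hind)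
  have hf : Measurable
      (fun p : β × (Fin d → ℝ) => A.indicator (fun _ => (1 : ℝ)) (Φ p.1 + p.2)) :=
    (measurable_const.indicator hA).comp ((hΦ.comp measurable_fst).add measurable_snd)
  have h := condExp_prod_ae_eq_integral_condDistrib (μ := μ) hZ
    hW.aemeasurable hf.stronglyMeasurable (by
      refine Integrable.of_bound (C := 1) ?_ ?_
      · exact ((measurable_const.indicator hA).comp
          ((hΦ.comp hZ).add hW)).aestronglyMeasurable
      · refine Filter.Eventually.of_forall fun ω => ?_
        simp only [Set.indicator]
        split_ifs <;> simp)
  have hcd' := ae_of_ae_map hZ.aemeasurable hcd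
  filter_upwards [h, hcd'] with ω h1 h2
  rw [h1, h2]
  simp

/-- Conditional law of `X + W` given `m` when `X` is `m`-measurable, `W` independent of `m`. -/
lemma condExp_add_indep {Ω' : Type*} {d : ℕ} (m : MeasurableSpace Ω') {mΩ : MeasurableSpace Ω'}
    (hm : m ≤ mΩ) (μ : Measure Ω')
    [IsProbabilityMeasure μ] (X W : Ω' → Fin d → ℝ) (hX : Measurable[m] X) (hW : Measurable W)
    (hi : Indep (MeasurableSpace.comap W inferInstance) m μ)
    (A : Set (Fin d → ℝ)) (hA : MeasurableSet A) :
    μ[fun ω => A.indicator (fun _ => (1 : ℝ)) (X ω + W ω) | m]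
      =ᵐ[μ] fun ω => ∫ w, A.indicator (fun _ => (1 : ℝ)) (X ω + w) ∂(μ.map W) := by
  have hid : @Measurable Ω' Ω' mΩ m id := measurable_id'' hm
  have hind : @IndepFun Ω' Ω' (Fin d → ℝ) mΩ m _ id W μ := by
    unfold IndepFun Kernel.IndepFun
    rw [MeasurableSpace.comap_id]
    exact hi.symm
  have := @condExp_add_indep_aux Ω' Ω' d m mΩ μ _ id X W hid hX hW hind A hA
  rwa [MeasurableSpace.comap_id] at this

/-- Equality of conditional probabilities extends to conditional expectations. -/
lemma condExp_eq_of_indicator {Ω' E : Type*} [MeasurableSpace E] {m₁ m₂ mΩ : MeasurableSpace Ω'}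
    (h₁ : m₁ ≤ mΩ) (h₂ : m₂ ≤ mΩ) (μ : Measure Ω')
    [IsProbabilityMeasure μ] (Y : Ω' → E) (hY : Measurable Y)
    (h : ∀ A : Set E, MeasurableSet A →
      μ[A.indicator (fun _ => (1 : ℝ)) ∘ Y | m₁] =ᵐ[μ] μ[A.indicator (fun _ => (1 : ℝ)) ∘ Y | m₂])
    (f : E → ℝ) (hf : Integrable f (μ.map Y)) :
    μ[f ∘ Y | m₁] =ᵐ[μ] μ[f ∘ Y | m₂] := by
  have hmp : MeasurePreserving Y μ (μ.map Y) := ⟨hY, rfl⟩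
  refine Integrable.induction (μ := μ.map Y)
    (fun f => μ[f ∘ Y | m₁] =ᵐ[μ] μ[f ∘ Y | m₂]) ?_ ?_ ?_ ?_ hf
  · intro c s hs _
    have e : (s.indicator fun _ => c) ∘ Y = c • (s.indicator (fun _ => (1 : ℝ)) ∘ Y) := by
      ext ω; simp [Set.indicator]
    simp only [e]
    filter_upwards [condExp_smul (μ := μ) c (s.indicator (fun _ => (1 : ℝ)) ∘ Y) m₁,
      condExp_smul (μ := μ) c (s.indicator (fun _ => (1 : ℝ)) ∘ Y) m₂, h s hs] with ω a1 a2 a3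
    rw [a1, a2, Pi.smul_apply, Pi.smul_apply, a3]
  · intro f g _ hf hg hf' hg'
    have e : (f + g) ∘ Y = f ∘ Y + g ∘ Y := rfl
    have if' := hf.comp_measurable hY
    have ig' := hg.comp_measurable hY
    simp only [e]
    filter_upwards [condExp_add if' ig' m₁, condExp_add if' ig' m₂, hf', hg'] with ω a1 a2 a3 a4
    rw [a1, a2, Pi.add_apply, Pi.add_apply, a3, a4]
  · have key : {f : E →₁[μ.map Y] ℝ | μ[f ∘ Y | m₁] =ᵐ[μ] μ[f ∘ Y | m₂]} =
        {f : E →₁[μ.map Y] ℝ |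
          condExpL1CLM ℝ h₁ μ (Lp.compMeasurePreservingₗᵢ ℝ Y hmp f) =
          condExpL1CLM ℝ h₂ μ (Lp.compMeasurePreservingₗᵢ ℝ Y hmp f)} := by
      ext f
      simp only [Set.mem_ofPred_eq]
      have hi : Integrable (f ∘ Y) μ := (L1.integrable_coeFn f).comp_measurable hY
      have e : hi.toL1 (f ∘ Y) = Lp.compMeasurePreservingₗᵢ ℝ Y hmp f := by
        apply Lp.ext
        refine (Integrable.coeFn_toL1 hi).trans ?_
        exact (Lp.coeFn_compMeasurePreserving f hmp).symm
      have e1 := condExp_ae_eq_condExpL1CLM h₁ hi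
      have e2 := condExp_ae_eq_condExpL1CLM h₂ hi
      rw [e] at e1 e2
      constructor
      · intro hh
        exact Lp.ext (e1.symm.trans (hh.trans e2))
      · intro hh
        rw [hh] at e1
        exact e1.trans e2.symm
    rw [key]
    exact isClosed_eq (by fun_prop) (by fun_prop)
  · intro f g hfg _ hf'
    have e : f ∘ Y =ᵐ[μ] g ∘ Y := ae_of_ae_map hY.aemeasurable hfg
    exact (condExp_congr_ae e.symm).trans (hf'.trans (condExp_congr_ae e))

/-- A vector that is Gaussian in the Cramér–Wold sense has a Gaussian law. -/
lemma hasGaussianLaw_of {ι : Type*} [Fintype ι] {μ : Measure Ω}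
    {X : Ω → ι → ℝ} (hX : Measurable X) {C : Matrix ι ι ℝ} (h : IsZeroMeanGaussian μ X C) :
    HasGaussianLaw X μ := by
  classical
  refine ⟨isGaussian_of_map_eq_gaussianReal fun L => ?_⟩
  refine ⟨0, ((fun i => L (Pi.single i 1)) ⬝ᵥ
    C.mulVec (fun i => L (Pi.single i 1))).toNNReal, ?_⟩
  · rw [Measure.map_map (by fun_prop) hX, ← h (fun i => L (Pi.single i 1))]
    congr 1
    ext ω
    have := L.toLinearMap.pi_apply_eq_sum_univ (X ω)
    simp only [ContinuousLinearMap.coe_coe] at this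
    simp only [Function.comp_apply]
    rw [this]
    refine Finset.sum_congr rfl fun i _ => ?_
    rw [smul_eq_mul, mul_comm]
    congr 2
    ext j
    simp [Pi.single_apply, eq_comm]

lemma variance_of {ι : Type*} [Fintype ι] {μ : Measure Ω}
    {X : Ω → ι → ℝ} (hX : Measurable X) {C : Matrix ι ι ℝ} (hC : C.PosDef)
    (h : IsZeroMeanGaussian μ X C) (l : ι → ℝ) :
    Var[fun ω => ∑ i, l i * X ω i; μ] = l ⬝ᵥ C.mulVec l := by
  have hm : Measurable (fun ω => ∑ i, l i * X ω i) := by fun_prop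
  have := variance_map (X := id) (Y := fun ω => ∑ i, l i * X ω i) (μ := μ)
    measurable_id.aemeasurable hm.aemeasurable
  rw [h l, variance_id_gaussianReal] at this
  have h0 : 0 ≤ l ⬝ᵥ C.mulVec l := by
    simpa using hC.posSemidef.dotProduct_mulVec_nonneg l
  rw [Real.coe_toNNReal _ h0] at this
  rw [this]; rfl

lemma mean_of {ι : Type*} [Fintype ι] {μ : Measure Ω}
    {X : Ω → ι → ℝ} (hX : Measurable X) {C : Matrix ι ι ℝ}
    (h : IsZeroMeanGaussian μ X C) (i : ι) :
    ∫ ω, X ω i ∂μ = 0 := by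
  classical
  have hm : Measurable (fun ω => ∑ j, (Pi.single i 1 : ι → ℝ) j * X ω j) := by fun_prop
  have := integral_map (μ := μ) (f := id) hm.aemeasurable
    measurable_id.aestronglyMeasurable
  rw [h] at this
  simp only [id, integral_id_gaussianReal] at this
  rw [this]
  simp [Pi.single_apply]

lemma memLp_of {ι : Type*} [Fintype ι] {μ : Measure Ω}
    {X : Ω → ι → ℝ} (hX : Measurable X) {C : Matrix ι ι ℝ}
    (h : IsZeroMeanGaussian μ X C) (i : ι) : MemLp (fun ω => X ω i) 2 μ :=
  ((hasGaussianLaw_of hX h).eval i).memLp_two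

lemma cov_of {ι : Type*} [Fintype ι] {μ : Measure Ω} [IsProbabilityMeasure μ]
    {X : Ω → ι → ℝ} (hX : Measurable X) {C : Matrix ι ι ℝ} (hC : C.PosDef)
    (h : IsZeroMeanGaussian μ X C) (i j : ι) :
    cov[fun ω => X ω i, fun ω => X ω j; μ] = C i j := by
  classical
  have v := variance_of hX hC h
  have hi := memLp_of hX h i
  have hj := memLp_of hX h j
  have e := variance_add hi hj
  have vi := v (Pi.single i 1)
  have vj := v (Pi.single j 1)
  have vij := v (Pi.single i 1 + Pi.single j 1)
  have hs : C j i = C i j := by simpa using hC.1.apply i j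
  simp [Pi.single_apply, add_mul, Finset.sum_add_distrib, Matrix.mulVec_add, add_dotProduct,
    dotProduct_add] at vi vj vij
  have e' : Var[fun ω => X ω i + X ω j; μ] = Var[fun ω => X ω i; μ] +
    2 * cov[fun ω => X ω i, fun ω => X ω j; μ] + Var[fun ω => X ω j; μ] := e
  rw [vi, vj, vij, hs] at e'
  linarith

lemma measurable_stack {N d : ℕ} {x : ℕ → Ω → Fin d → ℝ} (h : ∀ k, k ≤ N → Measurable (x k)) :
    Measurable (stack N d x) := by
  refine measurable_pi_lambda _ fun p => ?_
  exact (measurable_pi_apply p.2).comp (h p.1 (by omega))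

lemma sigmaOf_le {N d : ℕ} {x : ℕ → Ω → Fin d → ℝ} (h : ∀ k, k ≤ N → Measurable (x k))
    {S : Set ℕ} (hS : ∀ i ∈ S, i ≤ N) : sigmaOf x S ≤ ‹MeasurableSpace Ω› :=
  iSup₂_le fun i hi => (h i (hS i hi)).comap_le

lemma measurable_sigmaOf {d : ℕ} (x : ℕ → Ω → Fin d → ℝ) {S : Set ℕ} {i : ℕ} (hi : i ∈ S) :
    Measurable[sigmaOf x S] (x i) :=
  measurable_iff_comap_le.2 (le_iSup₂_of_le i hi le_rfl)

lemma cov_residual {d : ℕ} {μ : Measure Ω} [IsProbabilityMeasure μ] {u v : Ω → Fin d → ℝ}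
    (hu : ∀ a, MemLp (fun ω => u ω a) 2 μ) (hv : ∀ a, MemLp (fun ω => v ω a) 2 μ)
    {Z : Ω → ℝ} (hZ : MemLp Z 2 μ) (P : Mat d) (a : Fin d) :
    cov[fun ω => (u ω - P.mulVec (v ω)) a, Z; μ] =
      cov[fun ω => u ω a, Z; μ] - ∑ c, P a c * cov[fun ω => v ω c, Z; μ] := by
  have e : (fun ω => (u ω - P.mulVec (v ω)) a) = fun ω => u ω a - ∑ c, P a c * v ω c := by
    ext ω; simp [Matrix.mulVec, dotProduct]
  have hs : ∀ c, MemLp (fun ω => P a c * v ω c) 2 μ := fun c => (hv c).const_mul _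
  rw [e, covariance_fun_sub_left (hu a) (memLp_finsetSum _ fun c _ => hs c) hZ,
    covariance_fun_sum_left hs hZ]
  simp only [covariance_const_mul_left]

/-- A residual `y k - P y j` uncorrelated with the states at times in `S` is independent of them. -/
lemma indep_of_cov {N d : ℕ} {μ : Measure Ω} {y : ℕ → Ω → Fin d → ℝ}
    {C : Matrix (Fin (N + 1) × Fin d) (Fin (N + 1) × Fin d) ℝ} (hy : ZMNG N d μ y C)
    {S : Set ℕ} (hS : ∀ i ∈ S, i ≤ N) {k j : ℕ} (hk : k ≤ N) (hj : j ≤ N) (P : Mat d)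
    (h : ∀ a, ∀ i ∈ S, ∀ b,
      cov[fun ω => (y k ω - P.mulVec (y j ω)) a, fun ω => y i ω b; μ] = 0) :
    Indep (MeasurableSpace.comap (fun ω => y k ω - P.mulVec (y j ω)) inferInstance)
      (sigmaOf y S) μ := by
  classical
  obtain ⟨hm, hg, -⟩ := hy
  have hG := hasGaussianLaw_of (measurable_stack hm) hg
  let κ := {p : Fin (N + 1) × Fin d // (p.1 : ℕ) ∈ S}
  let L : (Fin (N + 1) × Fin d → ℝ) →ₗ[ℝ] ((Fin d → ℝ) × (κ → ℝ)) :=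
    { toFun := fun v => (fun a => v (⟨k, by omega⟩, a) - ∑ c, P a c * v (⟨j, by omega⟩, c),
        fun p => v p.1)
      map_add' := by
        intro v w
        ext a
        · simp [mul_add, Finset.sum_add_distrib]; ring
        · simp
      map_smul' := by
        intro r v
        ext a
        · simp only [Pi.smul_apply, smul_eq_mul, RingHom.id_apply, Prod.smul_mk, mul_sub,
            Finset.mul_sum]
          congr 1
          exact Finset.sum_congr rfl fun c _ => by ring
        · simp }
  have hL := hG.map_fun L.toContinuousLinearMap
  have hI : IndepFun (fun ω a => (y k ω - P.mulVec (y j ω)) a)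
      (fun ω (p : κ) => y p.1.1 ω p.1.2) μ := by
    refine HasGaussianLaw.indepFun_of_covariance_eval
      (X := fun a ω => (y k ω - P.mulVec (y j ω)) a) (Y := fun (p : κ) ω => y p.1.1 ω p.1.2) ?_ ?_
    · exact hL
    · intro a p
      exact h a _ p.2 _
  rw [IndepFun_iff_Indep] at hI
  refine indep_of_indep_of_le_right hI ?_
  refine iSup₂_le fun i hi => ?_
  rw [← measurable_iff_comap_le]
  refine @measurable_pi_lambda _ _ _ (_) _ _ fun b => ?_
  have : (fun ω => y i ω b) = (fun f : κ → ℝ => f ⟨(⟨i, Nat.lt_succ_of_le (hS i hi)⟩, b), hi⟩) ∘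
      (fun ω (p : κ) => y p.1.1 ω p.1.2) := rfl
  rw [this]
  exact (measurable_pi_apply _).comp (comap_measurable _)

/-- The covariance recursion characterizing Gaussian Markov sequences. -/
def CovRec (N d : ℕ) (μ : Measure Ω) (y : ℕ → Ω → Fin d → ℝ) (Mm : ℕ → Mat d) : Prop :=
  ∀ k, 1 ≤ k → k ≤ N → ∀ i, i < k → ∀ a b,
    cov[fun ω => (y k ω - (Mm k).mulVec (y (k - 1) ω)) a, fun ω => y i ω b; μ] = 0

lemma zmng_memLp {N d : ℕ} {μ : Measure Ω} {y : ℕ → Ω → Fin d → ℝ}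
    {C : Matrix (Fin (N + 1) × Fin d) (Fin (N + 1) × Fin d) ℝ} (hy : ZMNG N d μ y C)
    {k : ℕ} (hk : k ≤ N) (a : Fin d) : MemLp (fun ω => y k ω a) 2 μ :=
  memLp_of (measurable_stack hy.1) hy.2.1 (⟨k, by omega⟩, a)

lemma zmng_mean {N d : ℕ} {μ : Measure Ω} {y : ℕ → Ω → Fin d → ℝ}
    {C : Matrix (Fin (N + 1) × Fin d) (Fin (N + 1) × Fin d) ℝ} (hy : ZMNG N d μ y C)
    {k : ℕ} (hk : k ≤ N) (a : Fin d) : ∫ ω, y k ω a ∂μ = 0 :=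
  mean_of (measurable_stack hy.1) hy.2.1 (⟨k, by omega⟩, a)

lemma zmng_cov {N d : ℕ} {μ : Measure Ω} [IsProbabilityMeasure μ] {y : ℕ → Ω → Fin d → ℝ}
    {C : Matrix (Fin (N + 1) × Fin d) (Fin (N + 1) × Fin d) ℝ} (hy : ZMNG N d μ y C)
    {k i : ℕ} (hk : k ≤ N) (hi : i ≤ N) (a b : Fin d) :
    cov[fun ω => y k ω a, fun ω => y i ω b; μ] = C (⟨k, by omega⟩, a) (⟨i, by omega⟩, b) :=
  cov_of (measurable_stack hy.1) hy.2.2 hy.2.1 (⟨k, by omega⟩, a) (⟨i, by omega⟩, b)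

/-- Iterating the recursion. -/
lemma covRec_iter {N d : ℕ} {μ : Measure Ω} [IsProbabilityMeasure μ] {y : ℕ → Ω → Fin d → ℝ}
    {C : Matrix (Fin (N + 1) × Fin d) (Fin (N + 1) × Fin d) ℝ} (hy : ZMNG N d μ y C)
    {Mm : ℕ → Mat d} (h : CovRec N d μ y Mm) (j : ℕ) (k : ℕ) (hjk : j ≤ k) (hk : k ≤ N) :
    ∃ P : Mat d, ∀ i, i ≤ j → ∀ a b,
      cov[fun ω => (y k ω - P.mulVec (y j ω)) a, fun ω => y i ω b; μ] = 0 := by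
  induction k, hjk using Nat.le_induction with
  | base =>
    refine ⟨1, fun i hi a b => ?_⟩
    simp
  | succ k hjk ih =>
    obtain ⟨P, hP⟩ := ih (by omega)
    refine ⟨Mm (k + 1) * P, fun i hi a b => ?_⟩
    have h1 := h (k + 1) (by omega) hk i (by omega) a b
    have mi := zmng_memLp hy (k := i) (by omega) b
    rw [cov_residual (zmng_memLp hy hk) (zmng_memLp hy (by omega)) mi] at h1 ⊢
    simp only [Nat.add_sub_cancel] at h1
    have h2 : ∀ c, cov[fun ω => y k ω c, fun ω => y i ω b; μ]
        = ∑ e, P c e * cov[fun ω => y j ω e, fun ω => y i ω b; μ] := by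
      intro c
      have := hP i hi c b
      rw [cov_residual (zmng_memLp hy (by omega)) (zmng_memLp hy (by omega)) mi] at this
      linarith
    rw [← h1]
    congr 1
    simp only [h2, Matrix.mul_apply, Finset.sum_mul, Finset.mul_sum]
    rw [Finset.sum_comm]
    exact Finset.sum_congr rfl fun c _ => Finset.sum_congr rfl fun e _ => by ring

lemma markov_of_covRec {N d : ℕ} {μ : Measure Ω} [IsProbabilityMeasure μ]
    {y : ℕ → Ω → Fin d → ℝ}
    {C : Matrix (Fin (N + 1) × Fin d) (Fin (N + 1) × Fin d) ℝ} (hy : ZMNG N d μ y C)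
    {Mm : ℕ → Mat d} (h : CovRec N d μ y Mm) : IsMarkovOn μ y 0 N := by
  intro j k _ hjk hk A hA
  obtain ⟨P, hP⟩ := covRec_iter hy h j k hjk.le hk
  have hW : Measurable (fun ω => y k ω - P.mulVec (y j ω)) := by
    have := hy.1 k hk
    have hj := hy.1 j (by omega)
    refine this.sub ?_
    exact (Continuous.measurable (by fun_prop : Continuous fun v : Fin d → ℝ => P.mulVec v)).comp hj
  have main : ∀ S : Set ℕ, j ∈ S → (∀ i ∈ S, i ≤ j) →
      μ[A.indicator (fun _ => (1 : ℝ)) ∘ y k | sigmaOf y S] =ᵐ[μ]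
        fun ω => ∫ w, A.indicator (fun _ => (1 : ℝ)) (P.mulVec (y j ω) + w)
          ∂(μ.map (fun ω => y k ω - P.mulVec (y j ω))) := by
    intro S hjS hS
    have hS' : ∀ i ∈ S, i ≤ N := fun i hi => by have := hS i hi; omega
    have := condExp_add_indep (sigmaOf y S) (sigmaOf_le hy.1 hS') μ
      (fun ω => P.mulVec (y j ω)) (fun ω => y k ω - P.mulVec (y j ω))
      ((Continuous.measurable (by fun_prop : Continuous fun v : Fin d → ℝ => P.mulVec v)).comp
        (measurable_sigmaOf y hjS)) hW
      (indep_of_cov hy hS' hk (by omega) P fun a i hi b => hP i (hS i hi) a b) A hA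
    convert this using 2
    ext ω
    simp
  exact (main _ (by simp) (by simp)).trans (main _ (by simp) (by simp)).symm

lemma covRec_of_markov {N d : ℕ} {μ : Measure Ω} [IsProbabilityMeasure μ]
    {y : ℕ → Ω → Fin d → ℝ}
    {C : Matrix (Fin (N + 1) × Fin d) (Fin (N + 1) × Fin d) ℝ} (hy : ZMNG N d μ y C)
    (h : IsMarkovOn μ y 0 N) : ∃ Mm, CovRec N d μ y Mm := by
  classical
  suffices H : ∀ k, ∃ P : Mat d, 1 ≤ k → k ≤ N → ∀ i, i < k → ∀ a b,
      cov[fun ω => (y k ω - P.mulVec (y (k - 1) ω)) a, fun ω => y i ω b; μ] = 0 by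
    choose Mm hMm using H
    exact ⟨Mm, hMm⟩
  intro k
  by_cases hk : 1 ≤ k ∧ k ≤ N
  swap
  · exact ⟨0, fun h1 h2 => absurd ⟨h1, h2⟩ hk⟩
  obtain ⟨hk1, hk⟩ := hk
  obtain ⟨j, rfl⟩ : ∃ j, k = j + 1 := ⟨k - 1, by omega⟩
  have hj : j ≤ N := by omega
  let Cjj : Mat d := C.submatrix (fun a => ((⟨j, by omega⟩ : Fin (N + 1)), a))
    (fun a => ((⟨j, by omega⟩ : Fin (N + 1)), a))
  let Ckj : Mat d := C.submatrix (fun a => ((⟨j + 1, by omega⟩ : Fin (N + 1)), a))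
    (fun a => ((⟨j, by omega⟩ : Fin (N + 1)), a))
  have hpd : Cjj.PosDef := hy.2.2.submatrix (by intro a b hab; simpa using hab)
  have hu : IsUnit Cjj.det := (Matrix.isUnit_iff_isUnit_det _).1 hpd.isUnit
  refine ⟨Ckj * Cjj⁻¹, fun _ _ i hi a b => ?_⟩
  set P := Ckj * Cjj⁻¹ with hPdef
  have hP : P * Cjj = Ckj := by rw [hPdef, Matrix.mul_assoc, Matrix.nonsing_inv_mul _ hu, mul_one]
  simp only [Nat.add_sub_cancel]
  have mk := zmng_memLp hy hk
  have mj := zmng_memLp hy hj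
  -- uncorrelated with `y j`
  have h0 : ∀ a b, cov[fun ω => (y (j + 1) ω - P.mulVec (y j ω)) a, fun ω => y j ω b; μ] = 0 := by
    intro a b
    rw [cov_residual mk mj (mj b), zmng_cov hy hk hj]
    simp only [zmng_cov hy hj hj]
    have := congrFun (congrFun hP a) b
    rw [Matrix.mul_apply] at this
    exact sub_eq_zero.2 this.symm
  have hSj : ∀ i ∈ ({j} : Set ℕ), i ≤ N := by simp [hj]
  have hSF : ∀ i ∈ Set.Icc 0 j, i ≤ N := by simp; omega
  have hind := indep_of_cov hy hSj hk hj P (fun a i hi b => by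
    rw [Set.mem_singleton_iff.1 hi]; exact h0 a b)
  have hle1 := sigmaOf_le hy.1 hSj
  have hle2 := sigmaOf_le hy.1 hSF
  have hmul : Measurable fun v : Fin d → ℝ => P.mulVec v :=
    Continuous.measurable (by fun_prop)
  let W : Ω → ℝ := fun ω => (y (j + 1) ω - P.mulVec (y j ω)) a
  let Q : Ω → ℝ := fun ω => P.mulVec (y j ω) a
  let U : Ω → ℝ := fun ω => y (j + 1) ω a
  have hWQ : W = U - Q := rfl
  have mQ : MemLp Q 2 μ := by
    have : Q = fun ω => ∑ c, P a c * y j ω c := by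
      ext ω; simp [Q, Matrix.mulVec, dotProduct]
    rw [this]
    exact memLp_finsetSum _ fun c _ => (mj c).const_mul _
  have mU : MemLp U 2 μ := mk a
  have mW : MemLp W 2 μ := mU.sub mQ
  have iQ : Integrable Q μ := mQ.integrable (by norm_num)
  have iU : Integrable U μ := mU.integrable (by norm_num)
  have iW : Integrable W μ := mW.integrable (by norm_num)
  have EW : ∫ ω, W ω ∂μ = 0 := by
    rw [hWQ, integral_sub' iU iQ]
    have : ∫ ω, Q ω ∂μ = 0 := by
      have : Q = fun ω => ∑ c, P a c * y j ω c := by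
        ext ω; simp [Q, Matrix.mulVec, dotProduct]
      rw [this, integral_finsetSum _ fun c _ =>
        ((mj c).integrable (by norm_num)).const_mul _]
      simp [integral_const_mul, zmng_mean hy hj]
    rw [this, zmng_mean hy hk, sub_zero]
  -- conditional expectation given `y j`
  have hcW1 : μ[W | sigmaOf y {j}] =ᵐ[μ] fun _ => 0 := by
    have hWm : Measurable (fun ω => y (j + 1) ω - P.mulVec (y j ω)) :=
      (hy.1 _ hk).sub (hmul.comp (hy.1 _ hj))
    have := condExp_indep_eq (f := W) hWm.comap_le hle1
      (Measurable.stronglyMeasurable ((measurable_pi_apply a).comp (comap_measurable _))) hind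
    rw [EW] at this
    exact this
  have hQm : ∀ S : Set ℕ, j ∈ S → StronglyMeasurable[sigmaOf y S] Q := fun S hS =>
    Measurable.stronglyMeasurable
      ((measurable_pi_apply a).comp (hmul.comp (measurable_sigmaOf y hS)))
  have hU : μ[U | sigmaOf y (Set.Icc 0 j)] =ᵐ[μ] μ[U | sigmaOf y {j}] := by
    have hYm := hy.1 _ hk
    refine condExp_eq_of_indicator hle2 hle1 μ (y (j + 1)) hYm
      (h j (j + 1) (by omega) (by omega) hk) (fun v => v a) ?_
    exact (integrable_map_measure (measurable_pi_apply a).aestronglyMeasurable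
      hYm.aemeasurable).2 iU
  have hcW2 : μ[W | sigmaOf y (Set.Icc 0 j)] =ᵐ[μ] fun _ => 0 := by
    have s1 := condExp_sub iU iQ (sigmaOf y (Set.Icc 0 j))
    have s2 := condExp_sub iU iQ (sigmaOf y {j})
    rw [condExp_of_stronglyMeasurable hle2 (hQm _ (by simp)) iQ] at s1
    rw [condExp_of_stronglyMeasurable hle1 (hQm _ (by simp)) iQ] at s2
    rw [← hWQ] at s1 s2
    filter_upwards [s1, s2, hU, hcW1] with ω a1 a2 a3 a4
    rw [a1, Pi.sub_apply, a3, ← a4, a2, Pi.sub_apply]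
  have mi := zmng_memLp hy (k := i) (by omega) b
  have hmul2 := condExp_mul_of_stronglyMeasurable_right (μ := μ) (m := sigmaOf y (Set.Icc 0 j))
    (f := W) (g := fun ω => y i ω b)
    (Measurable.stronglyMeasurable ((measurable_pi_apply b).comp
      (measurable_sigmaOf y (by simp; omega)))) (mW.integrable_mul mi) iW
  have hE : ∫ ω, (W * fun ω => y i ω b) ω ∂μ = 0 := by
    rw [← integral_condExp hle2]
    refine integral_eq_zero_of_ae ?_
    filter_upwards [hmul2, hcW2] with ω a1 a2
    rw [a1, Pi.mul_apply, a2, zero_mul]; rfl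
  change cov[W, fun ω => y i ω b; μ] = 0
  rw [covariance_eq_sub mW mi, hE, EW, zero_mul, sub_zero]

lemma covariance_congr_ae' {μ : Measure Ω} {X X' Y Y' : Ω → ℝ} (h : X =ᵐ[μ] X')
    (h' : Y =ᵐ[μ] Y') : cov[X, Y; μ] = cov[X', Y'; μ] := by
  simp only [covariance]
  rw [integral_congr_ae h, integral_congr_ae h']
  refine integral_congr_ae ?_
  filter_upwards [h, h'] with ω a b
  rw [a, b]

lemma covRec_of_model {N d : ℕ} {μ : Measure Ω} [IsProbabilityMeasure μ]
    {y : ℕ → Ω → Fin d → ℝ}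
    {C : Matrix (Fin (N + 1) × Fin d) (Fin (N + 1) × Fin d) ℝ} (hy : ZMNG N d μ y C)
    {Mm Mcov : ℕ → Mat d} (h : MarkovModel N d μ y Mm Mcov) : CovRec N d μ y Mm := by
  obtain ⟨e, he, -, hae⟩ := h
  have hee : ∀ k i, k ≤ N → i ≤ N → k ≠ i → ∀ a b,
      cov[fun ω => e k ω a, fun ω => e i ω b; μ] = 0 := by
    intro k i hk hi hki a b
    rw [zmng_cov he hk hi]
    simp [blockDiag, hki]
  have hey : ∀ i k, i < k → k ≤ N → ∀ a b,
      cov[fun ω => e k ω a, fun ω => y i ω b; μ] = 0 := by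
    intro i
    induction i with
    | zero =>
      intro k hik hk a b
      rw [← hee k 0 hk (by omega) (by omega) a b]
      refine covariance_congr_ae' Filter.EventuallyEq.rfl ?_
      filter_upwards [hae] with ω hω
      rw [hω.1]
    | succ i ih =>
      intro k hik hk a b
      have e1 : cov[fun ω => e k ω a, fun ω => y (i + 1) ω b; μ] =
          cov[fun ω => e k ω a, fun ω => (e (i + 1) ω - (-Mm (i + 1)).mulVec (y i ω)) b; μ] := by
        refine covariance_congr_ae' Filter.EventuallyEq.rfl ?_
        filter_upwards [hae] with ω hω
        rw [hω.2 (i + 1) (by omega) (by omega), Matrix.neg_mulVec, sub_neg_eq_add, add_comm]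
        rfl
      rw [e1, covariance_comm, cov_residual (zmng_memLp he (by omega)) (zmng_memLp hy (by omega))
        (zmng_memLp he hk a), hee (i + 1) k (by omega) hk (by omega)]
      simp only [covariance_comm (fun ω => y i ω _) (fun ω => e k ω a)]
      simp [ih k (by omega) hk]
  intro k hk1 hk i hi a b
  rw [← hey i k hi hk a b]
  refine covariance_congr_ae' ?_ Filter.EventuallyEq.rfl
  filter_upwards [hae] with ω hω
  rw [hω.2 k hk1 hk, add_sub_cancel_left]

/-- The noise sequence of the Markov model. -/
def noise {d : ℕ} (y : ℕ → Ω → Fin d → ℝ) (Mm : ℕ → Mat d) (k : ℕ) (ω : Ω) : Fin d → ℝ :=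
  if k = 0 then y 0 ω else y k ω - (Mm k).mulVec (y (k - 1) ω)

/-- The matrix mapping the stacked sequence to the stacked noise. -/
def noiseMat (N d : ℕ) (Mm : ℕ → Mat d) :
    Matrix (Fin (N + 1) × Fin d) (Fin (N + 1) × Fin d) ℝ :=
  fun p q => (if p = q then 1 else 0) - (if (q.1 : ℕ) + 1 = p.1 then Mm p.1 p.2 q.2 else 0)

lemma noiseMat_zero {N d : ℕ} (Mm : ℕ → Mat d) (v : Fin (N + 1) × Fin d → ℝ) (a : Fin d) :
    (noiseMat N d Mm).mulVec v (0, a) = v (0, a) := by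
  simp [noiseMat, Matrix.mulVec, dotProduct]

lemma noiseMat_succ {N d : ℕ} (Mm : ℕ → Mat d) (v : Fin (N + 1) × Fin d → ℝ) (k : ℕ)
    (hk : k + 1 < N + 1) (a : Fin d) :
    (noiseMat N d Mm).mulVec v (⟨k + 1, hk⟩, a) =
      v (⟨k + 1, hk⟩, a) - ∑ c, Mm (k + 1) a c * v (⟨k, by omega⟩, c) := by
  simp only [noiseMat, Matrix.mulVec, dotProduct, sub_mul, Finset.sum_sub_distrib]
  congr 1
  · simp
  · rw [Fintype.sum_prod_type, Finset.sum_eq_single (⟨k, by omega⟩ : Fin (N + 1))]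
    · simp
    · intro q _ hq
      refine Finset.sum_eq_zero fun c _ => ?_
      rw [if_neg, zero_mul]
      intro h
      apply hq
      ext
      simpa using h
    · simp

lemma noiseMat_isUnit {N d : ℕ} (Mm : ℕ → Mat d) : IsUnit (noiseMat N d Mm) := by
  rw [← Matrix.mulVec_injective_iff_isUnit]
  have : Function.Injective (noiseMat N d Mm).mulVecLin := by
    rw [injective_iff_map_eq_zero]
    intro v hv
    have hv' : (noiseMat N d Mm).mulVec v = 0 := hv
    have key : ∀ k (hk : k < N + 1) a, v (⟨k, hk⟩, a) = 0 := by
      intro k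
      induction k with
      | zero =>
        intro hk a
        have := noiseMat_zero Mm v a
        rw [hv'] at this
        exact this.symm
      | succ k ih =>
        intro hk a
        have := noiseMat_succ Mm v k hk a
        rw [hv'] at this
        simp only [ih (by omega), mul_zero, Finset.sum_const_zero, sub_zero] at this
        exact this.symm
    ext p
    exact key p.1 p.1.2 p.2
  exact this

lemma stack_noise {N d : ℕ} (y : ℕ → Ω → Fin d → ℝ) (Mm : ℕ → Mat d) (ω : Ω) :
    stack N d (noise y Mm) ω = (noiseMat N d Mm).mulVec (stack N d y ω) := by
  ext ⟨⟨k, hk⟩, a⟩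
  cases k with
  | zero =>
    rw [show (⟨0, hk⟩ : Fin (N + 1)) = 0 from rfl, noiseMat_zero]
    simp [stack, noise]
  | succ k =>
    rw [noiseMat_succ]
    simp [stack, noise, Matrix.mulVec, dotProduct]

lemma model_of_covRec {N d : ℕ} {μ : Measure Ω} [IsProbabilityMeasure μ]
    {y : ℕ → Ω → Fin d → ℝ}
    {C : Matrix (Fin (N + 1) × Fin d) (Fin (N + 1) × Fin d) ℝ} (hy : ZMNG N d μ y C)
    {Mm : ℕ → Mat d} (h : CovRec N d μ y Mm) : ∃ Mcov, MarkovModel N d μ y Mm Mcov := by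
  set T := noiseMat N d Mm with hT
  set D := T * C * Tᵀ with hD
  have hDpd : D.PosDef := by
    have := hy.2.2.mul_mul_conjTranspose_same (B := T)
      (Matrix.vecMul_injective_iff_isUnit.2 (noiseMat_isUnit Mm))
    simpa [hD] using this
  have hmeas : ∀ k, k ≤ N → Measurable (noise y Mm k) := by
    intro k hk
    have hmul : Measurable fun v : Fin d → ℝ => (Mm k).mulVec v :=
      Continuous.measurable (by fun_prop)
    unfold noise
    split_ifs
    · exact hy.1 0 (by omega)
    · exact (hy.1 k hk).sub (hmul.comp (hy.1 (k - 1) (by omega)))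
  have hez : ZMNG N d μ (noise y Mm) D := by
    refine ⟨hmeas, ?_, hDpd⟩
    intro l
    have e1 : (fun ω => ∑ i, l i * stack N d (noise y Mm) ω i) =
        fun ω => ∑ i, (l ᵥ* T) i * stack N d y ω i := by
      ext ω
      rw [stack_noise]
      exact Matrix.dotProduct_mulVec l T (stack N d y ω)
    rw [e1, hy.2.1 (l ᵥ* T)]
    congr 2
    rw [hD, ← Matrix.mulVec_mulVec, ← Matrix.mulVec_mulVec, Matrix.dotProduct_mulVec l T,
      Matrix.mulVec_transpose]
  have hey : ∀ k, k ≤ N → ∀ i, i < k → ∀ a b,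
      cov[fun ω => noise y Mm k ω a, fun ω => y i ω b; μ] = 0 := by
    intro k hk i hi a b
    rw [← h k (by omega) hk i hi a b]
    simp [noise, show k ≠ 0 by omega]
  have hee : ∀ k, k ≤ N → ∀ i, i < k → ∀ a b,
      cov[fun ω => noise y Mm k ω a, fun ω => noise y Mm i ω b; μ] = 0 := by
    intro k hk i hi a b
    by_cases h0 : i = 0
    · subst h0
      simpa [noise] using hey k hk 0 hi a b
    · have e1 : (fun ω => noise y Mm i ω b) =
          fun ω => (y i ω - (Mm i).mulVec (y (i - 1) ω)) b := by
        ext ω; simp [noise, h0]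
      rw [e1, covariance_comm, cov_residual (zmng_memLp hy (by omega)) (zmng_memLp hy (by omega))
        (zmng_memLp hez hk a)]
      simp only [covariance_comm (fun ω => y _ ω _) (fun ω => noise y Mm k ω a)]
      simp [hey k hk i hi, hey k hk (i - 1) (by omega)]
  let Mcov : ℕ → Mat d := fun k => if hk : k < N + 1 then
    D.submatrix (fun a => (⟨k, hk⟩, a)) (fun a => (⟨k, hk⟩, a)) else 1
  have hblock : blockDiag N d Mcov = D := by
    ext ⟨⟨k, hk⟩, a⟩ ⟨⟨i, hi⟩, b⟩
    simp only [blockDiag]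
    split_ifs with hki
    · subst hki
      simp only [Mcov]
      rw [dif_pos hk]
      try rfl
    · rw [← zmng_cov hez (by omega : k ≤ N) (by omega : i ≤ N) a b]
      rcases Nat.lt_or_gt_of_ne hki with hlt | hlt
      · rw [covariance_comm, hee i (by omega) k hlt]
      · rw [hee k (by omega) i hlt]
  refine ⟨Mcov, noise y Mm, ?_, ?_, ?_⟩
  · rw [hblock]; exact hez
  · intro k hk
    have hk' : k < N + 1 := by omega
    simp only [Mcov, hk', dif_pos]
    exact hDpd.submatrix (by intro a b hab; simpa using hab)
  · refine Filter.Eventually.of_forall fun ω => ⟨by simp [noise], fun k hk1 hk => ?_⟩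
    simp [noise, show k ≠ 0 by omega]

end Helpers

/-- A zero-mean nonsingular Gaussian sequence `[y_k]`, `k ∈ [0,N]`,
is Markov iff it obeys a Markov model. -/
theorem stmt8 {N d : ℕ} (hN : 3 ≤ N) (hd : 1 ≤ d)
    (μ : Measure Ω) [IsProbabilityMeasure μ] (y : ℕ → Ω → Fin d → ℝ)
    (C : Matrix (Fin (N + 1) × Fin d) (Fin (N + 1) × Fin d) ℝ)
    (hy : ZMNG N d μ y C) :
    IsMarkovOn μ y 0 N ↔ ∃ Mm Mcov : ℕ → Mat d, MarkovModel N d μ y Mm Mcov := by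
  constructor
  · intro h
    obtain ⟨Mm, hM⟩ := covRec_of_markov hy h
    exact ⟨Mm, model_of_covRec hy hM⟩
  · rintro ⟨Mm, Mcov, h⟩
    exact markov_of_covRec hy (covRec_of_model hy h)

end CMSeqPaper
end
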